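/- Let S be a domain that is either a complete local Noetherian ring, or finitely generated as an algebra over a field or over ℤ, or, more generally, finitely generated over a Noetherian integrally closed domain R with the property that every finitely generated R-algebra has module-finite integral closure. Let 𝔞_• be a filtration and 𝔟_• a graded family of nonzero ideals in S. Suppose ℛ^{[k]}(𝔟_•) is a standard graded S-algebra and ρ(𝔞_•, overline{𝔟_k^•}) = k·ρ(𝔞_•, overline{𝔟_1^•}), where 𝔟_j^• = {𝔟_j^i}_{i≥1} and overline{𝔟_j^•} = {overline{𝔟_j^i}}_{i≥1}. Then ρ̂(𝔞_•, 𝔟_•) = ρ̂(𝔞_•, 𝔟̄_•) = ρ(𝔞_•, 𝔟̄_•). -/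

import Mathlib

open Filter Polynomial
open scoped ENNReal NNReal

set_option synthInstance.maxHeartbeats 1000000
set_option maxHeartbeats 1000000

universe u

section Preamble

variable {S : Type u} [CommRing S]

/-- A graded family of ideals: `a 0 = S` and `a p * a q ⊆ a (p + q)` for all `p, q`. -/
def GradedFamily (a : ℕ → Ideal S) : Prop :=
  a 0 = ⊤ ∧ ∀ p q : ℕ, a p * a q ≤ a (p + q)

/-- A filtration of ideals: a graded family which is descending. -/
def IdealFiltration (a : ℕ → Ideal S) : Prop :=
  GradedFamily a ∧ ∀ p : ℕ, a (p + 1) ≤ a p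

/-- The integral closure of an ideal `I`: the ideal of all elements `x` satisfying an
equation of integral dependence `x ^ n + c 1 * x ^ (n - 1) + ⋯ + c n = 0` with `c i ∈ I ^ i`. -/
noncomputable def intClosure (I : Ideal S) : Ideal S :=
  Ideal.span {x : S | ∃ n : ℕ, 0 < n ∧ ∃ c : ℕ → S,
    (∀ i, 1 ≤ i → i ≤ n → c i ∈ I ^ i) ∧
    x ^ n + ∑ i ∈ Finset.Icc 1 n, c i * x ^ (n - i) = 0}

/-- The resurgence `ρ(a, b) = sup { s / r : ¬ a s ⊆ b r }` (as an extended real number,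
with `sSup ∅ = ⊥`). -/
noncomputable def resurgence (a b : ℕ → Ideal S) : EReal :=
  sSup {x : EReal | ∃ s r : ℕ, 0 < s ∧ 0 < r ∧ ¬ a s ≤ b r ∧
    x = (((s : ℝ) / (r : ℝ) : ℝ) : EReal)}

/-- The asymptotic resurgence `ρ̂(a, b) = sup { s / r : ¬ a (s*t) ⊆ b (r*t) for all t ≫ 1}`. -/
noncomputable def asympResurgence (a b : ℕ → Ideal S) : EReal :=
  sSup {x : EReal | ∃ s r : ℕ, 0 < s ∧ 0 < r ∧
    (∀ᶠ t : ℕ in atTop, ¬ a (s * t) ≤ b (r * t)) ∧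
    x = (((s : ℝ) / (r : ℝ) : ℝ) : EReal)}

/-- The `k`-th Veronese subalgebra of the Rees algebra of the graded family `b` is a
standard graded `S`-algebra, i.e. `b (k*n) = (b k) ^ n` for all `n ≥ 1`. -/
def StdVeronese (b : ℕ → Ideal S) (k : ℕ) : Prop :=
  ∀ n : ℕ, 1 ≤ n → b (k * n) = b k ^ n

/-- The Rees algebra `ℛ(b) = ⊕ₙ bₙ tⁿ ⊆ S[t]` of a graded family, as a set of polynomials. -/
def ReesSet (b : ℕ → Ideal S) : Set (Polynomial S) :=
  {p : Polynomial S | ∀ n : ℕ, p.coeff n ∈ b n}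

/-- `ℛ(b')` is a finitely generated `ℛ(b)`-module: there is a finite set `G ⊆ ℛ(b')`
such that every element of `ℛ(b')` is an `ℛ(b)`-linear combination of elements of `G`. -/
def ReesFGModule (b b' : ℕ → Ideal S) : Prop :=
  ∃ G : Finset (Polynomial S), (G : Set (Polynomial S)) ⊆ ReesSet b' ∧
    ∀ p ∈ ReesSet b', ∃ c : Polynomial S → Polynomial S,
      (∀ g ∈ G, c g ∈ ReesSet b) ∧ p = ∑ g ∈ G, c g * g

/-- A graded family `b` is `bb`-equivalent (for an ideal `bb`) if for some `k`,
`b (i + k) ⊆ bb ^ i ⊆ b i` for all `i ≥ 1`. -/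
def BEquivalent (bb : Ideal S) (b : ℕ → Ideal S) : Prop :=
  ∃ k : ℕ, ∀ i : ℕ, 1 ≤ i → b (i + k) ≤ bb ^ i ∧ bb ^ i ≤ b i

/-- `β_n(a, b) = inf { d ≥ 1 : ¬ a n ⊆ b d }`, with `inf ∅ = ∞`. -/
noncomputable def betaIdx (a b : ℕ → Ideal S) (n : ℕ) : ℕ∞ :=
  sInf {d : ℕ∞ | ∃ m : ℕ, 0 < m ∧ ¬ a n ≤ b m ∧ d = (m : ℕ∞)}

/-- `ρ^n(a, b) = sup { s / β_s(a, b) : s ≥ n, β_s(a, b) < ∞ }`. -/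
noncomputable def rhoN (a b : ℕ → Ideal S) (n : ℕ) : EReal :=
  sSup {x : EReal | ∃ s d : ℕ, n ≤ s ∧ 0 < s ∧ betaIdx a b s = (d : ℕ∞) ∧
    x = (((s : ℝ) / (d : ℝ) : ℝ) : EReal)}

/-- `ρ^lim(a, b) = lim_{n → ∞} ρ^n(a, b)`, the limit of the nonincreasing sequence `ρ^n`,
i.e. its infimum. -/
noncomputable def rhoLim (a b : ℕ → Ideal S) : EReal :=
  ⨅ n : ℕ, rhoN a b n

end Preamble

section Valuations

variable {S : Type u} [CommRing S] [IsDomain S]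

/-- A (discrete) valuation of the quotient field `K` of `S`: a function `v : K → ℤ` with
`v (x * y) = v x + v y` and `v (x + y) ≥ min (v x) (v y)` (for nonzero elements). -/
structure ValuationOn (S : Type u) [CommRing S] [IsDomain S] where
  v : FractionRing S → ℤ
  map_mul : ∀ x y : FractionRing S, x ≠ 0 → y ≠ 0 → v (x * y) = v x + v y
  min_le_map_add : ∀ x y : FractionRing S, x ≠ 0 → y ≠ 0 → x + y ≠ 0 →
    min (v x) (v y) ≤ v (x + y)

/-- A valuation of the quotient field is supported on `S` if it is nonnegative on `S`. -/
def ValuationOn.Supported (w : ValuationOn S) : Prop :=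
  ∀ x : S, x ≠ 0 → 0 ≤ w.v (algebraMap S (FractionRing S) x)

/-- `v(I) = min { v x : x ∈ I, x ≠ 0 }`. -/
noncomputable def idealVal (w : ValuationOn S) (I : Ideal S) : ℤ :=
  sInf {m : ℤ | ∃ x ∈ I, x ≠ 0 ∧ w.v (algebraMap S (FractionRing S) x) = m}

/-- The skew Waldschmidt constant `v̂(a) = inf_{n ≥ 1} v(a n) / n (= lim_{n → ∞} v(a n)/n)`. -/
noncomputable def skewWald (w : ValuationOn S) (a : ℕ → Ideal S) : ℝ :=
  sInf {t : ℝ | ∃ n : ℕ, 0 < n ∧ t = (idealVal w (a n) : ℝ) / (n : ℝ)}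

/-- `β_n^v(a, b) = inf { d ≥ 1 : v(a n) < v(b d) }`, with `inf ∅ = ∞`. -/
noncomputable def betaVal (w : ValuationOn S) (a b : ℕ → Ideal S) (n : ℕ) : ℕ∞ :=
  sInf {d : ℕ∞ | ∃ m : ℕ, 0 < m ∧ idealVal w (a n) < idealVal w (b m) ∧ d = (m : ℕ∞)}

end Valuations

section Domains

/-- `S` is a finitely generated algebra over a field. -/
structure FieldBase (S : Type u) [CommRing S] where
  F : Type u
  [fld : Field F]
  [alg : Algebra F S]
  fg : Algebra.FiniteType F S

/-- `S` is finitely generated over a Noetherian integrally closed domain `R` with the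
property that every finitely generated `R`-algebra (domain) has module-finite integral
closure (in its fraction field). -/
structure NagataBase (S : Type u) [CommRing S] where
  R : Type u
  [cring : CommRing R]
  [dom : IsDomain R]
  [noeth : IsNoetherianRing R]
  [intClosed : IsIntegrallyClosed R]
  [alg : Algebra R S]
  fg : Algebra.FiniteType R S
  finiteIntegralClosure : ∀ (A : Type u) [CommRing A] [IsDomain A] [Algebra R A],
    Algebra.FiniteType R A → Module.Finite A (integralClosure A (FractionRing A))

/-- `S` is a complete local Noetherian ring, or finitely generated over a field or over `ℤ`,
or, more generally, finitely generated over a Noetherian integrally closed domain `R` such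
that every finitely generated `R`-algebra has a module-finite integral closure. -/
def AdmissibleDomain (S : Type u) [CommRing S] : Prop :=
  (IsNoetherianRing S ∧ ∃ m : Ideal S, m.IsMaximal ∧ (∀ I : Ideal S, I.IsMaximal → I = m) ∧
    IsAdicComplete m S)
  ∨ Nonempty (FieldBase S) ∨ Algebra.FiniteType ℤ S ∨ Nonempty (NagataBase S)

end Domains

universe v

/-- A submodule on which linear functionals separate points is finitely generated, provided
it spans a finite-dimensional space. -/
theorem Submodule.fg_of_separating {R : Type*} {K : Type*} {V : Type*} [CommRing R] [IsDomain R]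
    [IsNoetherianRing R] [Field K] [Algebra R K] [IsFractionRing R K] [AddCommGroup V]
    [Module R V] [Module K V] [IsScalarTower R K V] [FiniteDimensional K V]
    (M : Submodule R V) (h : ∀ x : M, x ≠ 0 → ∃ l : M →ₗ[R] R, l x ≠ 0) :
    Module.Finite R M := by
  classical
  -- for a finite set of functionals, the span of the joint kernel
  let N : Finset (M →ₗ[R] R) → Submodule K V := fun F =>
    Submodule.span K ((fun x : M => (x : V)) '' {x : M | ∀ l ∈ F, l x = 0})
  obtain ⟨F, hF⟩ : ∃ F, ∀ G, Module.finrank K (N F) ≤ Module.finrank K (N G) := by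
    have := WellFounded.has_min (measure fun F => Module.finrank K (N F)).wf Set.univ
      Set.univ_nonempty
    obtain ⟨F, -, hF⟩ := this
    exact ⟨F, fun G => not_lt.mp (hF G trivial)⟩
  have key : ∀ x : M, (∀ l ∈ F, l x = 0) → x = 0 := by
    intro x hx
    by_contra hx0
    obtain ⟨l, hl⟩ := h x hx0
    let G := insert l F
    have hle : N G ≤ N F := by
      apply Submodule.span_mono
      apply Set.image_mono
      intro y hy l' hl'
      exact hy l' (Finset.mem_insert_of_mem hl')
    have heq : N G = N F := Submodule.eq_of_le_of_finrank_le hle (hF G)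
    have hxN : (x : V) ∈ N G := by
      rw [heq]
      exact Submodule.subset_span ⟨x, hx, rfl⟩
    -- clear denominators
    have claim : ∀ v ∈ N G, ∃ r : R, r ≠ 0 ∧ ∃ y : M, (y : V) = r • v ∧ l y = 0 := by
      intro v hv
      induction hv using Submodule.span_induction with
      | mem v hv =>
        obtain ⟨y, hy, rfl⟩ := hv
        exact ⟨1, one_ne_zero, y, by simp, hy l (Finset.mem_insert_self _ _)⟩
      | zero => exact ⟨1, one_ne_zero, 0, by simp, by simp⟩
      | add v w _ _ hv hw =>
        obtain ⟨r, hr, y, hy, hly⟩ := hv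
        obtain ⟨s, hs, z, hz, hlz⟩ := hw
        refine ⟨r * s, mul_ne_zero hr hs, s • y + r • z, ?_, by simp [hly, hlz]⟩
        simp only [Submodule.coe_add, Submodule.coe_smul, hy, hz, smul_add, smul_smul]
        rw [mul_comm s r]
      | smul a v _ hv =>
        obtain ⟨r, hr, y, hy, hly⟩ := hv
        obtain ⟨n, d, hd, rfl⟩ := IsFractionRing.div_surjective (A := R) a
        have hd0 : d ≠ 0 := nonZeroDivisors.ne_zero hd
        refine ⟨r * d, mul_ne_zero hr hd0, n • y, ?_, by simp [hly]⟩
        have h1 : algebraMap R K d ≠ 0 := by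
          simpa using hd0
        simp only [Submodule.coe_smul, hy]
        rw [← algebraMap_smul K n, ← algebraMap_smul K r v, ← algebraMap_smul K (r * d), smul_smul,
          smul_smul]
        congr 1
        rw [map_mul]
        field_simp
    obtain ⟨r, hr, y, hy, hly⟩ := claim _ hxN
    have : y = r • x := Subtype.ext (by simpa using hy)
    rw [this, map_smul, smul_eq_mul] at hly
    exact (mul_ne_zero hr hl) hly
  let Φ : M →ₗ[R] (F → R) := LinearMap.pi fun l => l.1
  have hΦ : Function.Injective Φ := by
    rw [← LinearMap.ker_eq_bot, LinearMap.ker_eq_bot']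
    intro x hx
    exact key x fun l hl => congrFun hx ⟨l, hl⟩
  have := isNoetherian_of_injective Φ hΦ
  infer_instance

/-- The ring has enough `p⁻¹`-linear functionals. -/
def CartierSeparating (R : Type*) [CommRing R] (p : ℕ) : Prop :=
  ∀ s : R, s ≠ 0 → ∃ l : R →+ R, (∀ a b : R, l (a ^ p * b) = a * l b) ∧ l s ≠ 0

theorem cartierSeparating_one (R : Type*) [CommRing R] : CartierSeparating R 1 :=
  fun s hs => ⟨AddMonoidHom.id R, by simp, hs⟩

theorem CartierSeparating.pow {R : Type*} [CommRing R] {p : ℕ} (h : CartierSeparating R p) (n : ℕ) :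
    CartierSeparating R (p ^ n) := by
  induction n with
  | zero => simpa using cartierSeparating_one R
  | succ n ih =>
    intro s hs
    obtain ⟨l, hl, hs'⟩ := ih s hs
    obtain ⟨m, hm, hs''⟩ := h _ hs'
    refine ⟨m.comp l, fun a b => ?_, hs''⟩
    rw [pow_succ', pow_mul]
    simp [hl, hm]

/-- A domain has finite normalization if its integral closure in its fraction field is a finite
module. -/
def FiniteNormalization (A : Type*) [CommRing A] : Prop :=
  Module.Finite A (integralClosure A (FractionRing A))

theorem finite_integralClosure_of_cartierSeparating (R K L : Type*) [CommRing R] [IsDomain R]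
    [IsNoetherianRing R] [IsIntegrallyClosed R] [Field K] [Algebra R K] [IsFractionRing R K]
    [Field L] [Algebra K L] [Algebra R L] [IsScalarTower R K L] [FiniteDimensional K L] (p : ℕ)
    [ExpChar R p] (hp : CartierSeparating R p) : Module.Finite R (integralClosure R L) := by
  classical
  have : ExpChar K p := expChar_of_injective_algebraMap (IsFractionRing.injective R K) p
  have : ExpChar L p := expChar_of_injective_algebraMap (algebraMap K L).injective p
  let E := separableClosure K L
  have tower : IsScalarTower R E L := IsScalarTower.of_algebraMap_eq fun r => by
    rw [IsScalarTower.algebraMap_apply R K L, IsScalarTower.algebraMap_apply K E L,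
      ← IsScalarTower.algebraMap_apply R K E]
  have : FiniteDimensional E L := inferInstance
  have : FiniteDimensional K E := inferInstance
  obtain ⟨n, hn⟩ : ∃ n : ℕ, ∀ b : L, b ^ p ^ n ∈ (algebraMap E L).range := by
    refine ⟨IsPurelyInseparable.exponent E L, fun b => ?_⟩
    have : ExpChar E p := expChar_of_injective_algebraMap (algebraMap K E).injective p
    have := IsPurelyInseparable.elemExponent_le_exponent (K := E) b
    have h := IsPurelyInseparable.exponent_def' (K := E) (ringExpChar E) b
    rwa [ringExpChar.eq E p] at h
  choose f hf using hn
  have finj : Function.Injective (algebraMap E L) := (algebraMap E L).injective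
  have fadd : ∀ a b, f (a + b) = f a + f b := fun a b => finj (by
    rw [map_add, hf, hf, hf, add_pow_expChar_pow])
  have fzero : f 0 = 0 := finj (by
    rw [hf, map_zero, zero_pow (pow_ne_zero _ (expChar_ne_zero L p))])
  have fsmul : ∀ (r : R) a, f (r • a) = (r ^ p ^ n) • f a := fun r a => finj (by
    rw [hf, Algebra.smul_def, mul_pow, ← map_pow, ← hf, Algebra.smul_def, map_mul,
      ← IsScalarTower.algebraMap_apply])
  have fint : ∀ a, IsIntegral R a → IsIntegral R (f a) := fun a ha => by
    have : IsIntegral R (algebraMap E L (f a)) := by rw [hf]; exact ha.pow _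
    exact (isIntegral_algebraMap_iff finj).mp this
  refine Submodule.fg_of_separating (K := K) (Subalgebra.toSubmodule (integralClosure R L)) ?_
  rintro ⟨b, hb⟩ hb0
  have hb0' : b ≠ 0 := fun h => hb0 (Subtype.ext h)
  have hfb : f b ≠ 0 := fun h => hb0' (by
    have := hf b
    rw [h, map_zero] at this
    exact pow_eq_zero_iff (pow_ne_zero _ (expChar_ne_zero L p)) |>.mp this.symm)
  -- an integral element with nonzero trace against `f b`
  obtain ⟨c, hc, hct⟩ : ∃ c : E, IsIntegral R c ∧ Algebra.trace K E (c * f b) ≠ 0 := by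
    obtain ⟨d, hd⟩ : ∃ d : E, Algebra.trace K E d ≠ 0 := by
      by_contra! h
      exact Algebra.trace_ne_zero K E (LinearMap.ext h)
    have halg : IsAlgebraic R (d * (f b)⁻¹) := by
      have : Algebra.IsAlgebraic R E := by
        exact (IsFractionRing.comap_isAlgebraic_iff (A := R) (K := K) (C := E)).mpr inferInstance
      exact Algebra.IsAlgebraic.isAlgebraic _
    obtain ⟨r, hr, hri⟩ := halg.exists_integral_multiple
    refine ⟨_, hri, ?_⟩
    rw [smul_mul_assoc, mul_assoc, inv_mul_cancel₀ hfb, mul_one, ← algebraMap_smul K r d, map_smul,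
      smul_eq_mul]
    exact mul_ne_zero (by simpa using hr) hd
  have trint : ∀ a, IsIntegral R a → ∃ r : R, algebraMap R K r = Algebra.trace K E (c * f a) :=
    fun a ha => IsIntegrallyClosed.isIntegral_iff.mp
      (Algebra.isIntegral_trace (hc.mul (fint a ha)))
  choose! g hg using trint
  have Kinj := IsFractionRing.injective R K
  have hgb : g b ≠ 0 := fun h => hct (by rw [← hg b hb, h, map_zero])
  obtain ⟨l, hl, hl0⟩ := hp.pow n (g b) hgb
  refine ⟨{ toFun := fun x => l (g x), map_add' := fun x y => ?_, map_smul' := fun r x => ?_ }, hl0⟩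
  · rw [← map_add]
    congr 1
    apply Kinj
    rw [Submodule.coe_add, hg _ (x.2.add y.2), map_add, hg _ x.2, hg _ y.2, fadd, mul_add, map_add]
  · simp only [RingHom.id_apply, smul_eq_mul]
    rw [← hl]
    congr 1
    apply Kinj
    rw [hg _ (r • x).2, (algebraMap R K).map_mul, hg _ x.2, Submodule.coe_smul, fsmul,
      mul_smul_comm, ← algebraMap_smul K (r ^ p ^ n), map_smul, smul_eq_mul]

theorem FiniteNormalization.of_finite (R : Type*) {A : Type*} [CommRing R] [IsDomain R]
    [IsNoetherianRing R] [IsIntegrallyClosed R] (p : ℕ) [ExpChar R p] (hp : CartierSeparating R p)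
    [CommRing A] [IsDomain A] [Algebra R A] [Module.Finite R A]
    (hinj : Function.Injective (algebraMap R A)) : FiniteNormalization A := by
  let K := FractionRing R
  let L := FractionRing A
  have : FaithfulSMul R A := (faithfulSMul_iff_algebraMap_injective R A).mpr hinj
  have : FaithfulSMul R L := FaithfulSMul.trans R A L
  let : Algebra K L := FractionRing.liftAlgebra R L
  have : IsScalarTower R K L := inferInstance
  have : FiniteDimensional K L :=
    .of_isLocalization R A (nonZeroDivisors R)
  have h := finite_integralClosure_of_cartierSeparating R K L p hp
  have heq : ∀ x : L, IsIntegral A x → IsIntegral R x := fun x hx => isIntegral_trans x hx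
  have : Module.Finite R (integralClosure A L) := by
    refine Module.Finite.equiv (M := integralClosure R L) ?_
    exact
    { toFun := fun x => ⟨x.1, x.2.tower_top⟩
      invFun := fun x => ⟨x.1, heq _ x.2⟩
      map_add' := fun x y => rfl
      map_smul' := fun r x => rfl
      left_inv := fun x => rfl
      right_inv := fun x => rfl }
  exact Module.Finite.of_restrictScalars_finite R A _

section
variable {S : Type u} [CommRing S]

theorem setOf_C_mul_X_eq (I : Ideal S) : {(C r * X : S[X]) | r ∈ I} =
    (Submodule.map (monomial 1 : S →ₗ[S] S[X]) I : Set S[X]) := by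
  ext p
  simp [C_mul_X_eq_monomial]

theorem isIntegral_reesAlgebra_of_equation {I : Ideal S} {x : S} {n : ℕ} {c : ℕ → S}
    (hc : ∀ i, 1 ≤ i → i ≤ n → c i ∈ I ^ i)
    (h : x ^ n + ∑ i ∈ Finset.Icc 1 n, c i * x ^ (n - i) = 0) :
    IsIntegral (reesAlgebra I) (C x * X : S[X]) := by
  let d : ℕ → reesAlgebra I := fun i =>
    if hi : 1 ≤ i ∧ i ≤ n then ⟨monomial i (c i), reesAlgebra.monomial_mem.mpr (hc i hi.1 hi.2)⟩
    else 0
  by_cases hS : Subsingleton S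
  · have : (C x * X : S[X]) = 0 := Subsingleton.elim _ _
    rw [this]
    exact isIntegral_zero
  have : Nontrivial S := not_subsingleton_iff_nontrivial.mp hS
  refine ⟨X ^ n + ∑ i ∈ Finset.Icc 1 n, C (d i) * X ^ (n - i), monic_X_pow_add ?_, ?_⟩
  · refine (degree_sum_le _ _).trans_lt ?_
    refine (Finset.sup_lt_iff (WithBot.bot_lt_coe n)).mpr fun i hi => ?_
    have hi' := Finset.mem_Icc.mp hi
    refine (degree_C_mul_X_pow_le _ _).trans_lt ?_
    exact Nat.cast_lt.mpr (by omega)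
  · rw [eval₂_add, eval₂_X_pow, eval₂_finsetSum]
    have hterm : ∀ i ∈ Finset.Icc 1 n, eval₂ (algebraMap (reesAlgebra I) S[X]) (C x * X)
        (C (d i) * X ^ (n - i)) = C (c i * x ^ (n - i)) * X ^ n := by
      intro i hi
      have hi' := Finset.mem_Icc.mp hi
      have hd : algebraMap (reesAlgebra I) S[X] (d i) = C (c i) * X ^ i := by
        simp only [d, dif_pos hi']
        rw [C_mul_X_pow_eq_monomial]
        rfl
      rw [eval₂_mul, eval₂_C, eval₂_X_pow, hd, mul_pow, ← C_pow, C_mul]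
      have : (X : S[X]) ^ n = X ^ i * X ^ (n - i) := by rw [← pow_add]; congr 1; omega
      rw [this]
      ring
    rw [Finset.sum_congr rfl hterm, ← Finset.sum_mul, mul_pow, ← C_pow, ← map_sum, ← add_mul,
      ← C_add, h, C_0, zero_mul]

theorem equation_of_isIntegral_reesAlgebra {I : Ideal S} {x : S}
    (h : IsIntegral (reesAlgebra I) (C x * X : S[X])) :
    ∃ n : ℕ, 0 < n ∧ ∃ c : ℕ → S, (∀ i, 1 ≤ i → i ≤ n → c i ∈ I ^ i) ∧
      x ^ n + ∑ i ∈ Finset.Icc 1 n, c i * x ^ (n - i) = 0 := by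
  rw [← adjoin_monomial_eq_reesAlgebra, ← setOf_C_mul_X_eq] at h
  obtain ⟨p, hp, hx, hc⟩ := exists_monic_aeval_eq_zero_forall_mem_pow_of_isIntegral
    (by
      convert h
      exact Algebra.algebra_ext _ _ fun r => by
        change Polynomial.map (algebraMap S S) r = r
        simp) (I := I) (x := x) (S := S)
  -- multiply by `X` to make the degree positive
  refine ⟨p.natDegree + 1, Nat.succ_pos _,
    fun i => if i ≤ p.natDegree then p.coeff (p.natDegree - i) else 0, fun i _ hi => ?_, ?_⟩
  · simp only
    split_ifs with h'
    · have := hc (p.natDegree - i)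
      rwa [Nat.sub_sub_self h'] at this
    · exact zero_mem _
  · rw [aeval_eq_sum_range, Finset.sum_range_succ, hp.coeff_natDegree, one_smul] at hx
    have : x * (∑ i ∈ Finset.range p.natDegree, p.coeff i • x ^ i + x ^ p.natDegree) = 0 := by
      rw [hx, mul_zero]
    refine Eq.trans ?_ this
    rw [mul_add, add_comm, pow_succ']
    congr 1
    rw [← Finset.sum_subset (s₁ := Finset.Icc 1 p.natDegree)
      (Finset.Icc_subset_Icc_right (Nat.le_succ _)), Finset.mul_sum]
    · refine Finset.sum_bij' (fun i _ => p.natDegree - i) (fun i _ => p.natDegree - i) ?_ ?_ ?_ ?_ ?_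
      · intro i hi; simp at hi ⊢; omega
      · intro i hi; simp at hi ⊢; omega
      · intro i hi; simp at hi ⊢; omega
      · intro i hi; simp at hi ⊢; omega
      · intro i hi
        simp only [Finset.mem_Icc] at hi
        simp only
        rw [if_pos hi.2, smul_eq_mul, Nat.sub_add_comm hi.2, pow_succ]
        ring
    · intro i hi hi'
      simp only [Finset.mem_Icc] at hi hi'
      simp only
      rw [if_neg (by omega), zero_mul]

theorem mem_intClosure_iff_isIntegral {I : Ideal S} {x : S} :
    x ∈ intClosure I ↔ IsIntegral (reesAlgebra I) (C x * X : S[X]) := by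
  constructor
  · intro hx
    induction hx using Submodule.span_induction with
    | mem x hx =>
      obtain ⟨n, -, c, hc, h⟩ := hx
      exact isIntegral_reesAlgebra_of_equation hc h
    | zero => simpa using isIntegral_zero
    | add x y _ _ hx hy => rw [C_add, add_mul]; exact hx.add hy
    | smul a x _ hx =>
      have : IsIntegral (reesAlgebra I) (C a : S[X]) :=
        isIntegral_algebraMap (x := algebraMap S (reesAlgebra I) a)
      rw [smul_eq_mul, C_mul, mul_assoc]
      exact this.mul hx
  · intro h
    exact Ideal.subset_span (equation_of_isIntegral_reesAlgebra h)

theorem mem_intClosure_iff {I : Ideal S} {x : S} :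
    x ∈ intClosure I ↔ ∃ n : ℕ, 0 < n ∧ ∃ c : ℕ → S, (∀ i, 1 ≤ i → i ≤ n → c i ∈ I ^ i) ∧
      x ^ n + ∑ i ∈ Finset.Icc 1 n, c i * x ^ (n - i) = 0 :=
  ⟨fun h => equation_of_isIntegral_reesAlgebra (mem_intClosure_iff_isIntegral.mp h),
    fun h => Ideal.subset_span h⟩

theorem le_intClosure (I : Ideal S) : I ≤ intClosure I := fun x hx =>
  mem_intClosure_iff.mpr ⟨1, one_pos, fun _ => -x, fun i h1 h2 => by
    obtain rfl : i = 1 := by omega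
    simpa using hx, by simp⟩

theorem intClosure_mono {I J : Ideal S} (h : I ≤ J) : intClosure I ≤ intClosure J := fun x hx => by
  obtain ⟨n, hn, c, hc, he⟩ := mem_intClosure_iff.mp hx
  exact mem_intClosure_iff.mpr ⟨n, hn, c, fun i h1 h2 => Ideal.pow_right_mono h i (hc i h1 h2), he⟩

theorem mem_intClosure_of_pow_mem {J : Ideal S} {r t : ℕ} (ht : 0 < t) {x : S}
    (h : x ^ t ∈ intClosure (J ^ (r * t))) : x ∈ intClosure (J ^ r) := by
  obtain ⟨n, hn, c, hc, he⟩ := mem_intClosure_iff.mp h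
  refine mem_intClosure_iff.mpr ⟨n * t, by positivity,
    fun i => if t ∣ i then c (i / t) else 0, fun i h1 h2 => ?_, ?_⟩
  · simp only
    split_ifs with h'
    · obtain ⟨j, rfl⟩ := h'
      rw [Nat.mul_div_cancel_left _ ht]
      have := hc j (Nat.pos_of_mul_pos_left h1) (by nlinarith)
      rwa [← pow_mul, mul_assoc, pow_mul] at this
    · exact zero_mem _
  · refine Eq.trans ?_ he
    rw [mul_comm n t, pow_mul]
    congr 1
    symm
    refine Finset.sum_bij_ne_zero (fun i _ _ => t * i) ?_ ?_ ?_ ?_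
    · intro i hi _
      simp at hi ⊢
      exact ⟨Nat.mul_pos ht (by omega), Nat.mul_le_mul_left _ hi.2⟩
    · intro i _ _ j _ _ h
      exact Nat.eq_of_mul_eq_mul_left ht h
    · intro b hb hb0
      have hdvd : t ∣ b := by
        by_contra h'
        simp only [if_neg h', zero_mul] at hb0
        exact hb0 rfl
      obtain ⟨j, rfl⟩ := hdvd
      simp only [if_pos (dvd_mul_right _ _), Nat.mul_div_cancel_left _ ht, ← Nat.mul_sub,
        pow_mul] at hb0
      simp only [Finset.mem_Icc] at hb
      exact ⟨j, Finset.mem_Icc.mpr ⟨Nat.pos_of_mul_pos_left hb.1, by nlinarith [hb.2]⟩, hb0, rfl⟩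
    · intro i hi _
      simp only
      rw [if_pos (dvd_mul_right _ _), Nat.mul_div_cancel_left _ ht, ← Nat.mul_sub, pow_mul]

theorem intClosure_pow_le {J : Ideal S} {m n : ℕ} (h : m ≤ n) :
    intClosure (J ^ n) ≤ intClosure (J ^ m) := intClosure_mono (Ideal.pow_le_pow_right h)

end

section
variable {S : Type u} [CommRing S]

theorem GradedFamily.pow_le {b : ℕ → Ideal S} (hb : GradedFamily b) (i t : ℕ) :
    b i ^ t ≤ b (i * t) := by
  induction t with
  | zero => simp [hb.1]
  | succ t ih =>
    rw [pow_succ, Nat.mul_succ]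
    exact (Ideal.mul_mono_left ih).trans (hb.2 _ _)

theorem EReal.coe_div_le_of_forall {s r c : ℕ} (hr : 0 < r) {y : EReal}
    (h : ∀ N : ℕ, 0 < N → ((((s * N : ℕ) : ℝ) / ((r * N + c : ℕ) : ℝ) : ℝ) : EReal) ≤ y) :
    (((s : ℝ) / (r : ℝ) : ℝ) : EReal) ≤ y := by
  have hr' : (r : ℝ) ≠ 0 := by positivity
  have h1 : Tendsto (fun N : ℕ => ((s : ℝ) / (r + c / N) : ℝ)) atTop (nhds ((s : ℝ) / (r + 0))) :=
    tendsto_const_nhds.div (tendsto_const_nhds.add (_root_.tendsto_const_div_atTop_nhds_zero_nat _))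
      (by simpa using hr')
  rw [add_zero] at h1
  refine le_of_tendsto ((continuous_coe_real_ereal.tendsto _).comp h1) ?_
  filter_upwards [eventually_gt_atTop 0] with N hN
  refine le_trans (le_of_eq ?_) (h N hN)
  have hN' : (N : ℝ) ≠ 0 := by positivity
  simp only [Function.comp]
  congr 1
  push_cast
  field_simp

theorem asympResurgence_le_resurgence (a b : ℕ → Ideal S) :
    asympResurgence a b ≤ resurgence a b := by
  refine sSup_le ?_
  rintro x ⟨s, r, hs, hr, h, rfl⟩
  obtain ⟨t, ht, ht0⟩ := (h.and (eventually_gt_atTop 0)).exists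
  refine le_sSup ⟨s * t, r * t, by positivity, by positivity, ht, ?_⟩
  have : (t : ℝ) ≠ 0 := by positivity
  congr 1
  push_cast
  field_simp

theorem asympResurgence_anti (a : ℕ → Ideal S) {b b' : ℕ → Ideal S} (h : ∀ i, b i ≤ b' i) :
    asympResurgence a b' ≤ asympResurgence a b := by
  refine sSup_le ?_
  rintro x ⟨s, r, hs, hr, h', rfl⟩
  exact le_sSup ⟨s, r, hs, hr, h'.mono fun t ht h'' => ht (h''.trans (h _)), rfl⟩

theorem resurgence_anti (a : ℕ → Ideal S) {b b' : ℕ → Ideal S} (h : ∀ i, b i ≤ b' i) :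
    resurgence a b' ≤ resurgence a b := by
  refine sSup_le ?_
  rintro x ⟨s, r, hs, hr, h', rfl⟩
  exact le_sSup ⟨s, r, hs, hr, fun h'' => h' (h''.trans (h _)), rfl⟩

/-- The resurgence with respect to the integral closures of the powers of `b k` is bounded by `k`
times the asymptotic resurgence. -/
theorem resurgence_intClosure_pow_le {a b : ℕ → Ideal S} (ha : GradedFamily a) {k : ℕ} (hk : 0 < k)
    (hst : StdVeronese b k) :
    resurgence a (fun i => intClosure (b k ^ i)) ≤
      ((k : ℝ) : EReal) * asympResurgence a (fun i => intClosure (b i)) := by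
  refine sSup_le ?_
  rintro x ⟨s, r, hs, hr, h, rfl⟩
  obtain ⟨x, hx, hxn⟩ := SetLike.not_le_iff_exists.mp h
  have hle : (((s : ℝ) / ((k * r : ℕ) : ℝ) : ℝ) : EReal) ≤
      asympResurgence a (fun i => intClosure (b i)) := by
    refine le_sSup ⟨s, k * r, hs, by positivity, ?_, rfl⟩
    filter_upwards [eventually_gt_atTop 0] with t ht hle
    have h1 : x ^ t ∈ a (s * t) := ha.pow_le s t (Ideal.pow_mem_pow hx t)
    have h2 := hle h1
    rw [mul_assoc, hst (r * t) (Nat.mul_pos hr ht)] at h2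
    exact hxn (mem_intClosure_of_pow_mem ht h2)
  have hk' : (k : ℝ) ≠ 0 := by positivity
  have hr' : (r : ℝ) ≠ 0 := by positivity
  refine le_trans (le_of_eq ?_) (mul_le_mul_of_nonneg_left hle (by exact_mod_cast hk.le))
  rw [← EReal.coe_mul]
  congr 1
  push_cast
  field_simp

theorem EReal.le_of_mul_le_mul_natCast {k : ℕ} (hk : 0 < k) {x y : EReal}
    (h : ((k : ℝ) : EReal) * x ≤ ((k : ℝ) : EReal) * y) : x ≤ y := by
  have hk' : (k : ℝ) ≠ 0 := by positivity
  have h1 : (((k : ℝ)⁻¹ : ℝ) : EReal) * ((k : ℝ) : EReal) = 1 := by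
    rw [← EReal.coe_mul, inv_mul_cancel₀ hk', EReal.coe_one]
  have h2 := mul_le_mul_of_nonneg_left h
    (show (0 : EReal) ≤ (((k : ℝ)⁻¹ : ℝ) : EReal) by
      exact_mod_cast (inv_nonneg.mpr (Nat.cast_nonneg k)))
  rwa [← mul_assoc, ← mul_assoc, h1, one_mul, one_mul] at h2

theorem asympResurgence_le_intClosure {a b : ℕ → Ideal S} {k : ℕ} (hk : 0 < k)
    (hst : StdVeronese b k) {c : ℕ} (hc : ∀ n, intClosure (b k ^ (n + c)) ≤ b k ^ n) :
    asympResurgence a b ≤ asympResurgence a (fun i => intClosure (b i)) := by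
  refine sSup_le ?_
  rintro x ⟨s, r, hs, hr, h, rfl⟩
  refine EReal.coe_div_le_of_forall (c := c) hr fun N hN => ?_
  refine le_sSup ⟨s * k * N, k * (r * N + c), by positivity, by positivity, ?_, ?_⟩
  · obtain ⟨t₀, ht₀⟩ := eventually_atTop.mp h
    filter_upwards [eventually_ge_atTop t₀, eventually_gt_atTop 0] with t ht ht0 hle
    have hkN : 0 < k * N := by positivity
    refine ht₀ (k * N * t) (ht.trans (Nat.le_mul_of_pos_left _ hkN)) ?_
    have e1 : s * (k * N * t) = s * k * N * t := by ring
    have e2 : r * (k * N * t) = k * (r * N * t) := by ring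
    rw [e1, e2, hst _ (show 0 < r * N * t by positivity)]
    refine le_trans (hle.trans ?_) (hc _)
    rw [mul_assoc k, hst _ (show 0 < (r * N + c) * t by positivity)]
    refine intClosure_pow_le ?_
    rw [add_mul]
    exact Nat.add_le_add_left (Nat.le_mul_of_pos_right _ ht0) _
  · have hk' : (k : ℝ) ≠ 0 := by positivity
    have : (r * N + c : ℝ) ≠ 0 := by positivity
    congr 1
    push_cast
    field_simp

theorem resurgence_eq_of_intClosure_pow_le
    {a b : ℕ → Ideal S} (ha : IdealFiltration a) (hb : GradedFamily b) {k : ℕ} (hk : 0 < k)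
    (hst : StdVeronese b k)
    (hhyp : resurgence a (fun i => intClosure (b k ^ i)) =
      ((k : ℝ) : EReal) * resurgence a (fun i => intClosure (b 1 ^ i)))
    {c : ℕ} (hc : ∀ n, intClosure (b k ^ (n + c)) ≤ b k ^ n) :
    asympResurgence a b = asympResurgence a (fun i => intClosure (b i)) ∧
      asympResurgence a (fun i => intClosure (b i)) =
        resurgence a (fun i => intClosure (b i)) := by
  refine ⟨le_antisymm (asympResurgence_le_intClosure hk hst hc)
    (asympResurgence_anti a fun i => le_intClosure _),
    le_antisymm (asympResurgence_le_resurgence _ _) ?_⟩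
  have h1 := resurgence_intClosure_pow_le ha.1 hk hst
  rw [hhyp] at h1
  refine le_trans (resurgence_anti a fun i => intClosure_mono ?_) (EReal.le_of_mul_le_mul_natCast hk h1)
  simpa using hb.pow_le 1 i

end

section
variable {S : Type u} [CommRing S] {D : Type v} [CommRing D]

theorem exists_map_eq_C_mul_X_pow {J : Ideal S} {φ : D →+* PowerSeries S}
    (hC : ∀ s, ∃ d, φ d = PowerSeries.C s)
    (hX : ∀ g ∈ J, ∃ d, φ d = PowerSeries.C g * PowerSeries.X) (n : ℕ) (s : S) (hs : s ∈ J ^ n) :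
    ∃ d, φ d = PowerSeries.C s * PowerSeries.X ^ n := by
  induction hs using Submodule.pow_induction_on_left' with
  | algebraMap r => simpa using hC r
  | add x y i hx hy h1 h2 =>
    obtain ⟨d, hd⟩ := h1
    obtain ⟨e, he⟩ := h2
    exact ⟨d + e, by rw [map_add, hd, he, map_add, add_mul]⟩
  | mem_mul m hm i x hx h =>
    obtain ⟨d, hd⟩ := h
    obtain ⟨e, he⟩ := hX m hm
    exact ⟨e * d, by rw [map_mul, hd, he, map_mul, pow_succ]; ring⟩

theorem isIntegral_C_mul_X_pow {J : Ideal S} [Algebra D (PowerSeries S)]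
    (hC : ∀ s, ∃ d, algebraMap D (PowerSeries S) d = PowerSeries.C s)
    (hX : ∀ g ∈ J, ∃ d, algebraMap D (PowerSeries S) d = PowerSeries.C g * PowerSeries.X)
    (n : ℕ) (s : S) (hs : s ∈ intClosure (J ^ n)) :
    IsIntegral D (PowerSeries.C s * PowerSeries.X ^ n : PowerSeries S) := by
  obtain ⟨m, hm, c, hc, he⟩ := mem_intClosure_iff.mp hs
  have : ∀ i, ∃ d, i ∈ Finset.Icc 1 m →
      algebraMap D (PowerSeries S) d = PowerSeries.C (c i) * PowerSeries.X ^ (n * i) := by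
    intro i
    by_cases hi : i ∈ Finset.Icc 1 m
    · have hi' := Finset.mem_Icc.mp hi
      obtain ⟨d, hd⟩ := exists_map_eq_C_mul_X_pow hC hX (n * i) (c i)
        (by rw [pow_mul]; exact hc i hi'.1 hi'.2)
      exact ⟨d, fun _ => hd⟩
    · exact ⟨0, fun h => absurd h hi⟩
  choose d hd using this
  by_cases hD : Subsingleton D
  · have : (1 : PowerSeries S) = 0 := by
      rw [← map_one (algebraMap D _), Subsingleton.elim (1 : D) 0, map_zero]
    rw [← mul_one (PowerSeries.C s * PowerSeries.X ^ n), this, mul_zero]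
    exact isIntegral_zero
  have : Nontrivial D := not_subsingleton_iff_nontrivial.mp hD
  refine ⟨X ^ m + ∑ i ∈ Finset.Icc 1 m, C (d i) * X ^ (m - i), monic_X_pow_add ?_, ?_⟩
  · refine (degree_sum_le _ _).trans_lt ?_
    refine (Finset.sup_lt_iff (WithBot.bot_lt_coe m)).mpr fun i hi => ?_
    have hi' := Finset.mem_Icc.mp hi
    refine (degree_C_mul_X_pow_le _ _).trans_lt ?_
    exact Nat.cast_lt.mpr (by omega)
  · rw [eval₂_add, eval₂_X_pow, eval₂_finsetSum]
    have hterm : ∀ i ∈ Finset.Icc 1 m, eval₂ (algebraMap D (PowerSeries S))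
        (PowerSeries.C s * PowerSeries.X ^ n) (C (d i) * X ^ (m - i)) =
        PowerSeries.C (c i * s ^ (m - i)) * PowerSeries.X ^ (n * m) := by
      intro i hi
      have hi' := Finset.mem_Icc.mp hi
      rw [eval₂_mul, eval₂_C, eval₂_X_pow, hd i hi, mul_pow, ← map_pow, map_mul]
      have : (PowerSeries.X : PowerSeries S) ^ (n * m) =
          PowerSeries.X ^ (n * i) * (PowerSeries.X ^ n) ^ (m - i) := by
        rw [← pow_mul, ← pow_add, ← mul_add]
        congr 2
        omega
      rw [this]
      ring
    rw [Finset.sum_congr rfl hterm, ← Finset.sum_mul, mul_pow, ← map_pow, ← map_sum, ← pow_mul,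
      ← add_mul, ← map_add, he, map_zero, zero_mul]

theorem exists_intClosure_pow_le_of_finiteNormalization [IsDomain S] [IsDomain D]
    [IsNoetherianRing D] (hD : FiniteNormalization D) {J : Ideal S} (hJ : J ≠ ⊥)
    (φ : D →+* PowerSeries S) (hφ : Function.Injective φ)
    (hcoeff : ∀ d n, PowerSeries.coeff n (φ d) ∈ J ^ n)
    (hC : ∀ s, ∃ d, φ d = PowerSeries.C s)
    (hX : ∀ g ∈ J, ∃ d, φ d = PowerSeries.C g * PowerSeries.X) :
    ∃ c, ∀ n, intClosure (J ^ (n + c)) ≤ J ^ n := by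
  classical
  let algP : Algebra D (PowerSeries S) := φ.toAlgebra
  have : FaithfulSMul D (PowerSeries S) := (faithfulSMul_iff_algebraMap_injective _ _).mpr hφ
  let Q := FractionRing (PowerSeries S)
  let L := FractionRing D
  have : FaithfulSMul D Q := FaithfulSMul.trans D (PowerSeries S) Q
  let algQ : Algebra L Q := FractionRing.liftAlgebra D Q
  have : IsScalarTower D L Q := inferInstance
  have Qinj : Function.Injective (algebraMap (PowerSeries S) Q) := IsFractionRing.injective _ _
  have LQinj : Function.Injective (algebraMap L Q) := (algebraMap L Q).injective
  let M := integralClosure D L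
  have : Module.Finite D M := hD
  have : IsNoetherian D M := isNoetherian_of_isNoetherianRing_of_finite D M
  obtain ⟨g, hgJ, hg0⟩ := Submodule.exists_mem_ne_zero_of_ne_bot hJ
  have hz : ∀ (n : ℕ) (s : S), s ∈ intClosure (J ^ n) → ∃ z : M,
      algebraMap L Q z = algebraMap (PowerSeries S) Q (PowerSeries.C s * PowerSeries.X ^ n) := by
    intro n s hs
    obtain ⟨ds, hds⟩ := hC s
    obtain ⟨dg, hdg⟩ := hC g
    obtain ⟨dx, hdx⟩ := hX g hgJ
    have hdg0 : dg ≠ 0 := by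
      rintro rfl
      rw [map_zero] at hdg
      exact hg0 (PowerSeries.C_injective (by rw [← hdg, map_zero]))
    have hz : algebraMap L Q (algebraMap D L (ds * dx ^ n) / algebraMap D L (dg ^ n)) =
        algebraMap (PowerSeries S) Q (PowerSeries.C s * PowerSeries.X ^ n) := by
      rw [map_div₀, ← IsScalarTower.algebraMap_apply, ← IsScalarTower.algebraMap_apply,
        IsScalarTower.algebraMap_apply D (PowerSeries S) Q,
        IsScalarTower.algebraMap_apply D (PowerSeries S) Q, div_eq_iff, ← map_mul]
      · congr 1
        change φ _ = _ * φ _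
        rw [map_mul, map_pow, map_pow, hds, hdg, hdx]
        ring
      · rw [← IsScalarTower.algebraMap_apply, map_ne_zero_iff _ (FaithfulSMul.algebraMap_injective D Q)]
        exact pow_ne_zero _ hdg0
    refine ⟨⟨_, ?_⟩, hz⟩
    have h1 := (isIntegral_C_mul_X_pow (D := D) hC hX n s hs).map
      (IsScalarTower.toAlgHom D (PowerSeries S) Q)
    have h2 : IsIntegral D
        (algebraMap L Q (algebraMap D L (ds * dx ^ n) / algebraMap D L (dg ^ n))) := by
      rw [hz]
      exact h1
    exact (isIntegral_algebraMap_iff LQinj).mp h2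
  let Z : Set M := {z | ∃ (n : ℕ) (s : S), s ∈ intClosure (J ^ n) ∧
    algebraMap L Q z = algebraMap (PowerSeries S) Q (PowerSeries.C s * PowerSeries.X ^ n)}
  obtain ⟨F, hFZ, hF⟩ := (Submodule.fg_span_iff_fg_span_finset_subset Z).mp
    (IsNoetherian.noetherian (Submodule.span D Z))
  have hFZ' : ∀ z : M, ∃ n s, z ∈ F →
      algebraMap L Q z = algebraMap (PowerSeries S) Q (PowerSeries.C s * PowerSeries.X ^ n) := by
    intro z
    by_cases hzF : z ∈ F
    · obtain ⟨n, s, -, h⟩ := hFZ hzF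
      exact ⟨n, s, fun _ => h⟩
    · exact ⟨0, 0, fun h => absurd h hzF⟩
  choose e s hes using hFZ'
  refine ⟨F.sup e, fun n x hx => ?_⟩
  obtain ⟨z, hz⟩ := hz _ x hx
  have hzZ : z ∈ Submodule.span D (F : Set M) := by
    rw [← hF]
    exact Submodule.subset_span ⟨_, x, hx, hz⟩
  obtain ⟨d, -, hd⟩ := Submodule.mem_span_finset.mp hzZ
  have hsum : PowerSeries.C x * PowerSeries.X ^ (n + F.sup e) =
      ∑ w ∈ F, φ (d w) * (PowerSeries.C (s w) * PowerSeries.X ^ (e w)) := by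
    apply Qinj
    rw [← hz, ← hd, map_sum]
    have : ((∑ w ∈ F, d w • w : M) : L) = ∑ w ∈ F, (d w) • (w : L) := by simp
    rw [this, map_sum]
    refine Finset.sum_congr rfl fun w hw => ?_
    rw [map_mul, ← hes w hw, Algebra.smul_def, map_mul, ← IsScalarTower.algebraMap_apply,
      IsScalarTower.algebraMap_apply D (PowerSeries S) Q]
    rfl
  have hco := congrArg (PowerSeries.coeff (n + F.sup e)) hsum
  rw [PowerSeries.coeff_C_mul, PowerSeries.coeff_X_pow_self, mul_one, map_sum] at hco
  rw [hco]
  refine Ideal.sum_mem _ fun w hw => ?_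
  have hle : e w ≤ F.sup e := Finset.le_sup hw
  rw [← mul_assoc, PowerSeries.coeff_mul_X_pow', if_pos (by omega), PowerSeries.coeff_mul_C]
  refine Ideal.mul_mem_right _ _ (Ideal.pow_le_pow_right ?_ (hcoeff _ _))
  omega

end

theorem exists_addMonoidHom_smul_apply_ne_zero {k V : Type*} [Field k] [AddCommGroup V]
    [Module k V] {v : V} (hv : v ≠ 0) :
    ∃ f : V →+ k, (∀ (a : k) (w : V), f (a • w) = a * f w) ∧ f v ≠ 0 := by
  by_contra! h
  exact hv ((Module.forall_dual_apply_eq_zero_iff k v).mp fun f => h f.toAddMonoidHom f.map_smul)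

theorem cartierSeparating_field (k : Type*) [Field k] (p : ℕ) [ExpChar k p] :
    CartierSeparating k p := fun _ hs =>
  @exists_addMonoidHom_smul_apply_ne_zero k k _ _ (Module.compHom k (frobenius k p)) _ hs

theorem CartierSeparating.of_ringEquiv {R R' : Type*} [CommRing R] [CommRing R'] {p : ℕ}
    (h : CartierSeparating R p) (e : R ≃+* R') : CartierSeparating R' p := by
  intro s hs
  obtain ⟨l, hl, hl0⟩ := h (e.symm s) (by simpa using hs)
  refine ⟨(e.toAddMonoidHom.comp l).comp e.symm.toAddMonoidHom, fun a b => ?_, by simpa using hl0⟩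
  simp [hl]

theorem CartierSeparating.polynomial {R : Type*} [CommRing R] {p : ℕ} [ExpChar R p]
    (h : CartierSeparating R p) : CartierSeparating R[X] p := by
  have hp : 0 < p := expChar_pos R p
  intro s hs
  obtain ⟨m, hm⟩ : ∃ m, s.coeff m ≠ 0 := by
    by_contra! h
    exact hs (Polynomial.ext h)
  obtain ⟨l, hl, hl0⟩ := h _ hm
  let j := m % p
  let T : R[X] → R[X] := fun f =>
    ∑ n ∈ Finset.range (f.natDegree + 1), monomial n (l (f.coeff (p * n + j)))
  have hT : ∀ f n, (T f).coeff n = l (f.coeff (p * n + j)) := by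
    intro f n
    simp only [T, finsetSum_coeff, coeff_monomial, Finset.sum_ite_eq', Finset.mem_range]
    split_ifs with h'
    · rfl
    · rw [coeff_eq_zero_of_natDegree_lt, map_zero]
      nlinarith [Nat.mul_le_mul hp (le_refl n)]
  let T' : R[X] →+ R[X] := AddMonoidHom.mk' T fun f g => by
    ext n
    rw [coeff_add, hT, hT, hT, coeff_add, map_add]
  refine ⟨T', fun a b => ?_, fun h0 => hl0 ?_⟩
  · change T (a ^ p * b) = a * T b
    induction a using Polynomial.induction_on' with
    | add f g hf hg =>
      rw [add_pow_expChar, add_mul, add_mul, ← hf, ← hg]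
      exact map_add T' _ _
    | monomial i c =>
      ext n
      rw [hT, monomial_pow, ← C_mul_X_pow_eq_monomial, ← C_mul_X_pow_eq_monomial, mul_assoc,
        mul_assoc, coeff_C_mul, coeff_C_mul, hl, coeff_X_pow_mul', coeff_X_pow_mul']
      have hj : j < p := Nat.mod_lt _ hp
      by_cases hi : i ≤ n
      · have h1 : i * p ≤ p * n + j := by nlinarith
        rw [if_pos hi, if_pos h1, hT]
        congr 3
        rw [Nat.mul_sub, mul_comm i p, Nat.sub_add_comm (Nat.mul_le_mul_left p hi)]
      · have h1 : ¬ i * p ≤ p * n + j := by nlinarith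
        rw [if_neg hi, if_neg h1, map_zero]
  · have := congrArg (fun f => Polynomial.coeff f (m / p)) h0
    simp only [coeff_zero] at this
    have h2 := hT s (m / p)
    rw [Nat.div_add_mod] at h2
    exact h2.symm.trans this

theorem CartierSeparating.mvPolynomial {R : Type*} [CommRing R] {p : ℕ} [ExpChar R p]
    (h : CartierSeparating R p) (n : ℕ) : CartierSeparating (MvPolynomial (Fin n) R) p := by
  induction n with
  | zero => exact h.of_ringEquiv (MvPolynomial.isEmptyRingEquiv R (Fin 0)).symm
  | succ n ih =>
    have : ExpChar (MvPolynomial (Fin n) R) p :=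
      expChar_of_injective_algebraMap (MvPolynomial.C_injective (Fin n) R) p
    exact ih.polynomial.of_ringEquiv (MvPolynomial.finSuccEquiv R n).symm.toRingEquiv

theorem FiniteNormalization.of_finiteType_field (k : Type*) {A : Type*} [Field k] [CommRing A]
    [IsDomain A] [Algebra k A] [Algebra.FiniteType k A] : FiniteNormalization A := by
  obtain ⟨s, g, hg, hfin⟩ := exists_finite_inj_algHom_of_fg k A
  let p := ringExpChar k
  have : ExpChar (MvPolynomial (Fin s) k) p :=
    expChar_of_injective_algebraMap (MvPolynomial.C_injective (Fin s) k) p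
  let alg := g.toRingHom.toAlgebra
  have : Module.Finite (MvPolynomial (Fin s) k) A := hfin
  exact .of_finite (MvPolynomial (Fin s) k) p ((cartierSeparating_field k p).mvPolynomial s) hg

theorem exists_intClosure_pow_le_of_reesAlgebra {S : Type u} [CommRing S] [IsDomain S]
    [IsNoetherianRing S] {J : Ideal S} (hJ : J ≠ ⊥) (h : FiniteNormalization (reesAlgebra J)) :
    ∃ c, ∀ n, intClosure (J ^ (n + c)) ≤ J ^ n := by
  refine exists_intClosure_pow_le_of_finiteNormalization h hJ
    (Polynomial.coeToPowerSeries.ringHom.comp (reesAlgebra J).val.toRingHom) ?_ ?_ ?_ ?_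
  · exact Polynomial.coe_injective S |>.comp Subtype.val_injective
  · intro d n
    simpa using d.2 n
  · exact fun s => ⟨algebraMap S _ s, by simp⟩
  · exact fun g hg => ⟨⟨monomial 1 g, reesAlgebra.monomial_mem.mpr (by simpa using hg)⟩, by
      simp [← C_mul_X_eq_monomial]⟩

theorem exists_intClosure_pow_le_of_finiteType_field (k : Type*) {S : Type u} [Field k] [CommRing S]
    [IsDomain S] [Algebra k S] [Algebra.FiniteType k S] {J : Ideal S} (hJ : J ≠ ⊥) :
    ∃ c, ∀ n, intClosure (J ^ (n + c)) ≤ J ^ n := by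
  have : IsNoetherianRing S := Algebra.FiniteType.isNoetherianRing k S
  have : Algebra.FiniteType S (reesAlgebra J) :=
    (Subalgebra.fg_iff_finiteType _).mp (reesAlgebra.fg (IsNoetherian.noetherian J))
  have : Algebra.FiniteType k (reesAlgebra J) := .trans (S := S) ‹_› ‹_›
  exact exists_intClosure_pow_le_of_reesAlgebra hJ (.of_finiteType_field k)

theorem exists_intClosure_pow_le_of_nagataBase {S : Type u} [CommRing S]
    [IsDomain S] [IsNoetherianRing S] (B : NagataBase S) {J : Ideal S} (hJ : J ≠ ⊥) :
    ∃ c, ∀ n, intClosure (J ^ (n + c)) ≤ J ^ n := by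
  obtain ⟨R, fg, hR⟩ := B
  have : Algebra.FiniteType S (reesAlgebra J) :=
    (Subalgebra.fg_iff_finiteType _).mp (reesAlgebra.fg (IsNoetherian.noetherian J))
  exact exists_intClosure_pow_le_of_reesAlgebra hJ (hR _ (.trans (S := S) ‹_› ‹_›))

theorem Int.isJacobsonRing : IsJacobsonRing ℤ := by
  refine isJacobsonRing_iff_prime_eq.mpr fun P hP => ?_
  rcases eq_or_ne P ⊥ with rfl | h
  · refine le_antisymm (fun x hx => ?_) Ideal.le_jacobson
    have := Int.isUnit_iff.mp (Ideal.mem_jacobson_bot.mp hx (3 * x))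
    have : x ^ 2 = 0 := by
      rcases this with h | h <;> nlinarith [sq_nonneg x]
    simpa using this
  · have := hP.isMaximal h
    exact (this.eq_of_le (by simpa [Ideal.jacobson_eq_top_iff] using hP.ne_top)
      Ideal.le_jacobson).symm

theorem exists_natPrime_mem_of_finiteType_int {D : Type*} [CommRing D] [Algebra.FiniteType ℤ D]
    (P : Ideal D) [P.IsMaximal] : ∃ p : ℕ, p.Prime ∧ (p : D) ∈ P := by
  let fld := Ideal.Quotient.field P
  have := Int.isJacobsonRing
  have hft : Algebra.FiniteType ℤ (D ⧸ P) := .of_surjective (Ideal.Quotient.mkₐ ℤ P)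
    (Ideal.Quotient.mkₐ_surjective ℤ P)
  have : Module.Finite ℤ (D ⧸ P) := finite_of_finite_type_of_isJacobsonRing ℤ (D ⧸ P)
  obtain ⟨p, hp⟩ := CharP.exists (D ⧸ P)
  rcases CharP.char_is_prime_or_zero (D ⧸ P) p with h | rfl
  · exact ⟨p, h, Ideal.Quotient.eq_zero_iff_mem.mp (by simp)⟩
  · have : CharZero (D ⧸ P) := CharP.charP_to_charZero _
    exact (Int.not_isField (isField_of_isIntegral_of_isField (S := D ⧸ P)
      (algebraMap ℤ (D ⧸ P)).injective_int (Field.toIsField _))).elim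

theorem Module.Finite.of_forall_isMaximal {D M : Type*} [CommRing D] [AddCommGroup M] [Module D M]
    (h : ∀ P : Ideal D, P.IsMaximal → ∃ f ∉ P, ∃ N : Submodule D M, N.FG ∧
      ∀ m, ∃ k : ℕ, f ^ k • m ∈ N) : Module.Finite D M := by
  classical
  let T : Set D := {f | ∃ N : Submodule D M, N.FG ∧ ∀ m, ∃ k : ℕ, f ^ k • m ∈ N}
  have hT : Ideal.span T = ⊤ := by
    by_contra hne
    obtain ⟨P, hP, hle⟩ := Ideal.exists_le_maximal _ hne
    obtain ⟨f, hf, hN⟩ := h P hP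
    exact hf (hle (Ideal.subset_span hN))
  obtain ⟨s, hsT, hs⟩ := (Ideal.span_eq_top_iff_finite T).mp hT
  choose N hN hm using fun f : s => hsT f.2
  refine ⟨?_⟩
  have htop : (⨆ f : s, N f) = ⊤ := by
    refine eq_top_iff.mpr fun m _ => ?_
    refine Submodule.mem_of_span_eq_top_of_smul_pow_mem _ (s : Set D) hs m fun r => ?_
    obtain ⟨k, hk⟩ := hm r m
    exact ⟨k, le_iSup N r hk⟩
  rw [← htop]
  exact Submodule.fg_iSup _ hN

/-- A finitely generated algebra that is finite modulo a prime `p` over a polynomial ring is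
quasi-finite over that polynomial ring at each prime containing `p`. -/
theorem zariskisMainProperty_of_finite_quotient {R D : Type*} [CommRing R] [CommRing D]
    [Algebra R D] [Algebra.FiniteType R D] (P : Ideal D) [P.IsPrime] (p : R)
    (hp : algebraMap R D p ∈ P) (hfin : Module.Finite R (D ⧸ Ideal.span {algebraMap R D p})) :
    Algebra.ZariskisMainProperty R P := by
  let I : Ideal D := (P.under R).map (algebraMap R D)
  have hle : Ideal.span {algebraMap R D p} ≤ I := by
    rw [Ideal.span_singleton_le_iff_mem]
    exact Ideal.mem_map_of_mem _ hp
  have : Module.Finite R (D ⧸ I) := .of_surjective (Ideal.Quotient.factorₐ R hle).toLinearMap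
    (Ideal.Quotient.factor_surjective hle)
  have : Algebra.WeaklyQuasiFiniteAt R P := by
    have : (P.map (Ideal.Quotient.mk I)).IsPrime := by
      refine Ideal.map_isPrime_of_surjective Ideal.Quotient.mk_surjective ?_
      rw [Ideal.mk_ker]
      exact Ideal.map_comap_le
    exact .trans R (D ⧸ I) _
  exact .of_finiteType_of_weaklyQuasiFiniteAt P

theorem FiniteNormalization.of_zariskisMainProperty {R D : Type*} [CommRing R] [IsDomain R]
    [IsNoetherianRing R] [IsIntegrallyClosed R] [CharZero R] [CommRing D] [IsDomain D]
    [Algebra R D] [Algebra.FiniteType R D] (hinj : Function.Injective (algebraMap R D))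
    (P : Ideal D) [P.IsPrime] (h : Algebra.ZariskisMainProperty R P) :
    ∃ f ∉ P, ∃ N : Submodule D (integralClosure D (FractionRing D)), N.FG ∧
      ∀ m, ∃ k : ℕ, f ^ k • m ∈ N := by
  obtain ⟨f, hfP, hf, hinteg⟩ := Algebra.zariskisMainProperty_iff.mp h
  have hf0 : f ≠ 0 := fun h => hfP (h ▸ P.zero_mem)
  let L := FractionRing D
  let K := FractionRing R
  let algRL : Algebra R L := inferInstance
  have injRL : Function.Injective (algebraMap R L) := by
    rw [IsScalarTower.algebraMap_eq R D L]
    exact (IsFractionRing.injective D L).comp hinj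
  have : FaithfulSMul R L := (faithfulSMul_iff_algebraMap_injective R L).mpr injRL
  let algKL : Algebra K L := FractionRing.liftAlgebra R L
  have tower : IsScalarTower R K L := FractionRing.isScalarTower_liftAlgebra R L
  have algD : ∀ x : D, IsAlgebraic K (algebraMap D L x) := by
    intro x
    obtain ⟨m, hm⟩ := hinteg x
    have key : ∀ y : D, IsIntegral R y → IsAlgebraic K (algebraMap D L y) := fun y hy =>
      ((hy.map (IsScalarTower.toAlgHom R D L)).tower_top (A := K)).isAlgebraic
    have hf0' : algebraMap D L (f ^ m) ≠ 0 := by simpa using fun h => absurd h hf0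
    have := (key _ hm).mul (key _ (hf.pow m)).inv
    rwa [map_mul, mul_comm, inv_mul_cancel_left₀ hf0'] at this
  have : Algebra.IsAlgebraic K L := by
    refine ⟨fun z => ?_⟩
    obtain ⟨x, y, -, rfl⟩ := IsFractionRing.div_surjective (A := D) z
    rw [div_eq_mul_inv]
    exact (algD x).mul (algD y).inv
  have : Algebra.EssFiniteType D L := .of_isLocalization L (nonZeroDivisors D)
  have : Algebra.EssFiniteType R L := .comp R D L
  have : Algebra.EssFiniteType K L := .of_comp R K L
  have : FiniteDimensional K L := Algebra.finite_of_essFiniteType_of_isAlgebraic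
  have hfin : Module.Finite R (integralClosure R L) :=
    finite_integralClosure_of_cartierSeparating R K L 1 (cartierSeparating_one R)
  let ι : integralClosure R L →ₗ[R] integralClosure D L :=
    { toFun := fun x => ⟨x.1, x.2.tower_top⟩
      map_add' := fun _ _ => rfl
      map_smul' := fun _ _ => rfl }
  obtain ⟨s, hs⟩ := hfin
  refine ⟨f, hfP, Submodule.span D (ι '' s), Submodule.fg_span (s.finite_toSet.image _), ?_⟩
  have hmem : ∀ x, ι x ∈ Submodule.span D (ι '' s) := by
    intro x
    have hx : x ∈ Submodule.span R (s : Set (integralClosure R L)) := hs ▸ Submodule.mem_top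
    have := Submodule.mem_map_of_mem (f := ι) hx
    rw [Submodule.map_span] at this
    exact Submodule.span_le_restrictScalars R D _ this
  rintro ⟨m, hm⟩
  suffices ∃ k : ℕ, IsIntegral R (f ^ k • m) by
    obtain ⟨k, hk⟩ := this
    exact ⟨k, hmem ⟨_, hk⟩⟩
  obtain ⟨q, hq, hqm⟩ := hm
  choose e he using hinteg
  let k := ∑ i ∈ Finset.range q.natDegree, e (q.coeff i)
  refine ⟨k, .of_aeval_monic_of_isIntegral_coeff (p := (q.scaleRoots (f ^ k)).map (algebraMap D L))
    (((monic_scaleRoots_iff _).mpr hq).map _) ?_ ?_ ?_⟩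
  · rw [((monic_scaleRoots_iff _).mpr hq).natDegree_map, natDegree_scaleRoots]
    intro h0
    rw [hq.natDegree_eq_zero.mp h0, eval₂_one] at hqm
    exact one_ne_zero hqm
  · rw [eval_map, Algebra.smul_def, scaleRoots_eval₂_eq_zero _ hqm]
    exact isIntegral_zero
  · intro i
    rw [coeff_map, coeff_scaleRoots]
    refine IsIntegral.algebraMap ?_
    rcases lt_trichotomy i q.natDegree with hi | rfl | hi
    · have hle : e (q.coeff i) ≤ k * (q.natDegree - i) :=
        (Finset.single_le_sum (f := fun i => e (q.coeff i)) (fun _ _ => Nat.zero_le _)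
          (Finset.mem_range.mpr hi)).trans (Nat.le_mul_of_pos_right _ (by omega))
      rw [← pow_mul, ← Nat.sub_add_cancel hle, pow_add, mul_left_comm, mul_comm (q.coeff i)]
      exact (hf.pow _).mul (he _)
    · simpa [hq] using isIntegral_one
    · simpa [coeff_eq_zero_of_natDegree_lt hi] using isIntegral_zero

theorem FiniteNormalization.of_finiteType_int {D : Type*} [CommRing D] [IsDomain D] [CharZero D]
    [Algebra.FiniteType ℤ D] : FiniteNormalization D := by
  refine Module.Finite.of_forall_isMaximal fun P hP => ?_
  obtain ⟨p, hp, hpP⟩ := exists_natPrime_mem_of_finiteType_int P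
  have : Fact p.Prime := ⟨hp⟩
  let I : Ideal D := Ideal.span {(p : D)}
  have hI : I ≤ P := by rwa [Ideal.span_singleton_le_iff_mem]
  have : Nontrivial (D ⧸ I) := Ideal.Quotient.nontrivial_iff.mpr (ne_top_of_le_ne_top hP.ne_top hI)
  have hp0 : (p : D) ≠ 0 := by exact_mod_cast hp.ne_zero
  have pzero : (p : D ⧸ I) = 0 := by
    rw [← map_natCast (Ideal.Quotient.mk I), Ideal.Quotient.eq_zero_iff_mem]
    exact Ideal.mem_span_singleton_self _
  have : CharP (D ⧸ I) p := by
    refine (CharP.charP_iff_prime_eq_zero hp).mpr pzero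
  let algZ : Algebra (ZMod p) (D ⧸ I) := ZMod.algebra _ p
  have : Algebra.FiniteType ℤ (D ⧸ I) := .of_surjective (Ideal.Quotient.mkₐ ℤ I)
    (Ideal.Quotient.mkₐ_surjective ℤ I)
  have : Algebra.FiniteType (ZMod p) (D ⧸ I) := .of_restrictScalars_finiteType ℤ _ _
  obtain ⟨r, g, hg, hfin⟩ := exists_finite_inj_algHom_of_fg (ZMod p) (D ⧸ I)
  choose x hx using fun i => Ideal.Quotient.mk_surjective (I := I) (g (MvPolynomial.X i))
  let R := MvPolynomial (Fin r) ℤ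
  let φ : R →ₐ[ℤ] D := MvPolynomial.aeval x
  let red : R →+* MvPolynomial (Fin r) (ZMod p) := MvPolynomial.map (Int.castRingHom (ZMod p))
  have hred : Function.Surjective red :=
    MvPolynomial.map_surjective _ (ZMod.ringHom_surjective _)
  have hcomm : (Ideal.Quotient.mk I).comp φ.toRingHom = g.toRingHom.comp red := by
    refine MvPolynomial.ringHom_ext (by simp) fun i => ?_
    change Ideal.Quotient.mk I (MvPolynomial.aeval x (MvPolynomial.X i)) =
      g (MvPolynomial.map (Int.castRingHom (ZMod p)) (MvPolynomial.X i))
    rw [MvPolynomial.aeval_X, MvPolynomial.map_X, hx]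
  let alg : Algebra R D := φ.toRingHom.toAlgebra
  have : IsScalarTower ℤ R D := IsScalarTower.of_algebraMap_eq' (Subsingleton.elim _ _)
  have : Algebra.FiniteType R D := .of_restrictScalars_finiteType ℤ _ _
  have hinj : Function.Injective (algebraMap R D) := by
    have hdiv : ∀ (n : ℕ) (a : R), φ a = 0 → ∀ m, (p : ℤ) ^ n ∣ a.coeff m := by
      intro n
      induction n with
      | zero => simp
      | succ n ih =>
        intro a ha m
        have h1 : red a = 0 := hg (by
          have := RingHom.congr_fun hcomm a
          simpa [ha] using this.symm)
        obtain ⟨b, rfl⟩ : MvPolynomial.C (p : ℤ) ∣ a := by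
          rw [MvPolynomial.C_dvd_iff_dvd_coeff]
          intro i
          have := congr_arg (MvPolynomial.coeff i) h1
          rw [MvPolynomial.coeff_map, MvPolynomial.coeff_zero] at this
          exact (ZMod.intCast_zmod_eq_zero_iff_dvd _ _).mp this
        have hb : φ b = 0 := by
          have : (p : D) * φ b = 0 := by simpa using ha
          exact (mul_eq_zero.mp this).resolve_left hp0
        rw [MvPolynomial.coeff_C_mul, pow_succ']
        exact mul_dvd_mul_left _ (ih b hb m)
    refine (injective_iff_map_eq_zero φ).mpr fun a ha => MvPolynomial.ext _ _ fun m => ?_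
    by_contra hne
    obtain ⟨n, hn⟩ := (Int.finiteMultiplicity_iff (a := (p : ℤ))).mpr
      ⟨by simpa using hp.ne_one, hne⟩
    exact hn (hdiv _ a ha m)
  refine FiniteNormalization.of_zariskisMainProperty hinj P
    (zariskisMainProperty_of_finite_quotient P (p : R) ?_ ?_)
  · simpa using hpP
  · rw [map_natCast]
    refine RingHom.finite_algebraMap.mp ?_
    have hfin' := RingHom.Finite.comp (show g.toRingHom.Finite from hfin)
      (RingHom.Finite.of_surjective red hred)
    rwa [← hcomm] at hfin'

theorem exists_intClosure_pow_le_of_finiteType_int {S : Type u} [CommRing S]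
    [IsDomain S] [Algebra.FiniteType ℤ S] {J : Ideal S} (hJ : J ≠ ⊥) :
    ∃ c, ∀ n, intClosure (J ^ (n + c)) ≤ J ^ n := by
  have : IsNoetherianRing S := Algebra.FiniteType.isNoetherianRing ℤ S
  obtain ⟨p, hp⟩ := CharP.exists S
  rcases CharP.char_is_prime_or_zero S p with h | rfl
  · have : Fact p.Prime := ⟨h⟩
    let alg : Algebra (ZMod p) S := ZMod.algebra S p
    have : Algebra.FiniteType (ZMod p) S := .of_restrictScalars_finiteType ℤ _ _
    exact exists_intClosure_pow_le_of_finiteType_field (ZMod p) hJ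
  · have : CharZero S := CharP.charP_to_charZero S
    have : Algebra.FiniteType S (reesAlgebra J) :=
      (Subalgebra.fg_iff_finiteType _).mp (reesAlgebra.fg (IsNoetherian.noetherian J))
    have : @Algebra.FiniteType ℤ (reesAlgebra J) _ _ (Ring.toIntAlgebra _) := by
      have := Algebra.FiniteType.trans (R := ℤ) (S := S) (A := reesAlgebra J) ‹_› ‹_›
      rwa [Subsingleton.elim (Ring.toIntAlgebra (reesAlgebra J)) (reesAlgebra J).algebra']
    have : CharZero (reesAlgebra J) :=
      charZero_of_injective_algebraMap (FaithfulSMul.algebraMap_injective S (reesAlgebra J))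
    exact exists_intClosure_pow_le_of_reesAlgebra hJ .of_finiteType_int

/-- The subrings meeting an ideal trivially. -/
def Subring.AvoidsIdeal {E : Type*} [CommRing E] (I : Ideal E) (T : Subring E) : Prop :=
  ∀ x ∈ T, x ∈ I → x = 0

theorem Subring.AvoidsIdeal.exists_maximal {E : Type*} [CommRing E] {I : Ideal E} {T₀ : Subring E}
    (h : T₀.AvoidsIdeal I) : ∃ T, T₀ ≤ T ∧ Maximal (Subring.AvoidsIdeal I) T := by
  refine zorn_le_nonempty₀ {T : Subring E | T.AvoidsIdeal I} (fun c hc hchain y hy => ?_) T₀ h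
  refine ⟨sSup c, fun x hx hxI => ?_, fun z hz => le_sSup hz⟩
  obtain ⟨T, hT, hxT⟩ := (Subring.mem_sSup_of_directedOn ⟨y, hy⟩ hchain.directedOn).mp hx
  exact hc hT x hxT hxI

section

variable {E : Type*} [CommRing E] {I : Ideal E} {T : Subring E}

theorem Subring.mem_of_maximal_avoidsIdeal (hT : Maximal (Subring.AvoidsIdeal I) T) {a : E}
    (ha : ∀ g : T[X], aeval a g ∈ I → aeval a g = 0) : a ∈ T := by
  have hle : T ≤ (aeval (R := T) a).toRingHom.range := fun t ht => ⟨C ⟨t, ht⟩, by simp; rfl⟩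
  refine hT.2 (y := (aeval (R := T) a).toRingHom.range) ?_ hle ⟨X, by simp⟩
  rintro _ ⟨g, rfl⟩ hg
  exact ha g hg

theorem Subring.isField_of_maximal_avoidsIdeal (hT : Maximal (Subring.AvoidsIdeal I) T)
    (hI : I ≠ ⊤) (hu : ∀ x ∉ I, IsUnit x) : IsField T := by
  have : Nontrivial E := by
    by_contra h
    rw [not_nontrivial_iff_subsingleton] at h
    exact hI (Subsingleton.elim _ _)
  refine ⟨⟨0, 1, zero_ne_one⟩, mul_comm, fun {t} ht => ?_⟩
  have ht0 : (t : E) ≠ 0 := by simpa using ht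
  have htI : (t : E) ∉ I := fun h => ht0 (hT.1 _ t.2 h)
  obtain ⟨s, hs⟩ := (hu _ htI).exists_right_inv
  have hsT : s ∈ T := by
    refine Subring.mem_of_maximal_avoidsIdeal hT fun g hg => ?_
    have hmem : (t : E) ^ g.natDegree * aeval s g ∈ T := by
      rw [aeval_eq_sum_range, Finset.mul_sum]
      refine sum_mem fun i hi => ?_
      have hi : i ≤ g.natDegree := Nat.lt_succ_iff.mp (Finset.mem_range.mp hi)
      have : (t : E) ^ g.natDegree * g.coeff i • s ^ i =
          (g.coeff i : E) * (t : E) ^ (g.natDegree - i) := by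
        rw [Subring.smul_def, smul_eq_mul, ← Nat.sub_add_cancel hi, pow_add, Nat.sub_add_cancel hi]
        calc _ = (g.coeff i : E) * (t : E) ^ (g.natDegree - i) * ((t : E) * s) ^ i := by ring
          _ = _ := by rw [hs, one_pow, mul_one]
      rw [this]
      exact mul_mem (g.coeff i).2 (pow_mem t.2 _)
    have h0 := hT.1 _ hmem (I.mul_mem_left _ hg)
    exact ((hu _ htI).pow _).mul_right_eq_zero.mp h0
  exact ⟨⟨s, hsT⟩, Subtype.ext hs⟩

theorem Subring.mem_of_maximal_avoidsIdeal_of_irreducible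
    (hT : Maximal (Subring.AvoidsIdeal I) T) (hI : I ≠ ⊤) (hfield : IsField T) {f : T[X]}
    (hf : Irreducible f) {a : E} (ha : aeval a f = 0) : a ∈ T := by
  refine Subring.mem_of_maximal_avoidsIdeal hT fun g hg => ?_
  by_cases hdvd : f ∣ g
  · obtain ⟨q, rfl⟩ := hdvd
    rw [map_mul, ha, zero_mul]
  · let fld := hfield.toField
    obtain ⟨u, v, huv⟩ : IsCoprime f g := (Irreducible.coprime_iff_not_dvd hf).mpr hdvd
    have := congr_arg (aeval a) huv
    rw [map_add, map_mul, map_mul, ha, mul_zero, zero_add, map_one] at this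
    exact (hI ((Ideal.eq_top_iff_one I).mpr (this ▸ I.mul_mem_left _ hg))).elim

end

/-- A ring of characteristic `p` that is a thickening of a field has a coefficient field, provided
the `p`-th powers of the elements of the kernel vanish. -/
theorem exists_subring_section_of_pow_eq_zero {E : Type*} [CommRing E] {I : Ideal E}
    (hI : I.IsMaximal) (p : ℕ) [hp : Fact p.Prime] [CharP E p] (hpow : ∀ x ∈ I, x ^ p = 0) :
    ∃ T : Subring E, T.AvoidsIdeal I ∧ ∀ e, ∃ t ∈ T, e - t ∈ I := by
  have hu : ∀ x ∉ I, IsUnit x := by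
    intro x hx
    obtain ⟨y, i, hi, hxy⟩ := hI.exists_inv hx
    have : IsUnit (y * x) := by
      rw [← eq_sub_iff_add_eq] at hxy
      rw [hxy]
      exact IsNilpotent.isUnit_one_sub ⟨p, hpow i hi⟩
    exact isUnit_of_mul_isUnit_right this
  have h0 : (frobenius E p).range.AvoidsIdeal I := by
    rintro _ ⟨x, rfl⟩ hx
    exact hpow x (hI.isPrime.mem_of_pow_mem _ hx)
  obtain ⟨T, hle, hT⟩ := h0.exists_maximal
  have hfield := Subring.isField_of_maximal_avoidsIdeal hT hI.ne_top hu
  refine ⟨T, hT.1, fun a => ?_⟩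
  by_cases h : ∃ b : T, b ^ p = ⟨a ^ p, hle ⟨a, rfl⟩⟩
  · obtain ⟨b, hb⟩ := h
    refine ⟨b, b.2, hI.isPrime.mem_of_pow_mem p ?_⟩
    have hb' : (b : E) ^ p = a ^ p := congr_arg Subtype.val hb
    rw [sub_pow_char, hb', sub_self]
    exact I.zero_mem
  · push Not at h
    refine ⟨a, ?_, by simp⟩
    have hirr : Irreducible (X ^ p - C (⟨a ^ p, hle ⟨a, rfl⟩⟩ : T)) := by
      let fld := hfield.toField
      exact X_pow_sub_C_irreducible_of_prime hp.out h
    refine Subring.mem_of_maximal_avoidsIdeal_of_irreducible hT hI.ne_top hfield hirr ?_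
    rw [map_sub, map_pow, aeval_X, aeval_C]
    exact sub_self _

/-- A Henselian local ring whose residue field has characteristic zero has a coefficient field. -/
theorem exists_subring_section_of_charZero {D : Type*} [CommRing D] {I : Ideal D}
    (hI : I.IsMaximal) (hu : ∀ x ∉ I, IsUnit x) [HenselianRing D I] [CharZero (D ⧸ I)] :
    ∃ T : Subring D, T.AvoidsIdeal I ∧ ∀ e, ∃ t ∈ T, e - t ∈ I := by
  have h0 : (⊥ : Subring D).AvoidsIdeal I := by
    intro x hx hxI
    obtain ⟨n, rfl⟩ := Subring.mem_bot.mp hx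
    rw [← Ideal.Quotient.eq_zero_iff_mem, map_intCast, Int.cast_eq_zero] at hxI
    rw [hxI, Int.cast_zero]
  obtain ⟨T, -, hT⟩ := h0.exists_maximal
  have hfield := Subring.isField_of_maximal_avoidsIdeal hT hI.ne_top hu
  refine ⟨T, hT.1, fun a => ?_⟩
  by_cases h : ∀ g : T[X], aeval a g ∈ I → aeval a g = 0
  · exact ⟨a, Subring.mem_of_maximal_avoidsIdeal hT h, by simp⟩
  push Not at h
  obtain ⟨g, hgI, hg0⟩ := h
  let fld := hfield.toField
  let π := Ideal.Quotient.mk I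
  have haev : ∀ q : T[X], π (aeval a q) = aeval (π a) q := fun q => by
    rw [aeval_def, aeval_def, hom_eval₂]
    rfl
  have hnt : Nontrivial (D ⧸ I) := Ideal.Quotient.nontrivial_iff.mpr hI.ne_top
  have hinteg : IsIntegral T (π a) := by
    refine IsAlgebraic.isIntegral ⟨g, fun hg => hg0 (by rw [hg, map_zero]), ?_⟩
    rw [← haev]
    exact Ideal.Quotient.eq_zero_iff_mem.mpr hgI
  have hdom : IsDomain (D ⧸ I) := Ideal.Quotient.isDomain I
  have hirr : Irreducible (minpoly T (π a)) := minpoly.irreducible hinteg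
  have hchar : CharZero T := by
    refine charZero_of_inj_zero fun n hn => ?_
    have : ((algebraMap T (D ⧸ I)) n) = 0 := by rw [hn, map_zero]
    simpa using this
  have hsep : (minpoly T (π a)).Separable := hirr.separable
  have hder : aeval (π a) (derivative (minpoly T (π a))) ≠ 0 :=
    hsep.aeval_derivative_ne_zero (minpoly.aeval T _)
  let f : D[X] := (minpoly T (π a)).map (algebraMap T D)
  obtain ⟨a', ha', hsub⟩ := HenselianRing.is_henselian (I := I) f ((minpoly.monic hinteg).map _) a
    (by
      rw [eval_map_algebraMap, ← Ideal.Quotient.eq_zero_iff_mem]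
      exact (haev _).trans (minpoly.aeval T _))
    (by
      let fld' := Ideal.Quotient.field I
      refine isUnit_iff_ne_zero.mpr ?_
      rw [derivative_map, eval_map_algebraMap]
      exact fun h => hder ((haev _).symm.trans h))
  refine ⟨a', Subring.mem_of_maximal_avoidsIdeal_of_irreducible hT hI.ne_top hfield hirr ?_, ?_⟩
  · rw [← eval_map_algebraMap]
    exact ha'
  · rw [← neg_sub]
    exact I.neg_mem hsub

/-- A closed subring `W` of a ring with maximal ideal `I`, mapping onto the residue field, such
that `W ∩ I` is approximated by the multiples of `c` in `W`. -/
structure IsCoefficientSubring {D : Type*} [CommRing D] (I : Ideal D) (W : Subring D) (c : D) :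
    Prop where
  mem : c ∈ W
  mem_ideal : c ∈ I
  exists_sub_mem : ∀ d, ∃ w ∈ W, d - w ∈ I
  exists_sub_mul_mem : ∀ w ∈ W, w ∈ I → ∀ n, ∃ y ∈ W, w - c * y ∈ I ^ n
  closed : ∀ x, (∀ n, ∃ w ∈ W, x - w ∈ I ^ n) → x ∈ W

theorem IsPrecomplete.exists_forall_sub_mem {D : Type*} [CommRing D] {I : Ideal D}
    [IsPrecomplete I D] (k : ℕ) (f : ℕ → D) (hf : ∀ i, f (i + 1) - f i ∈ I ^ (i + k)) :
    ∃ L, ∀ i, L - f i ∈ I ^ (i + k) := by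
  have hle : ∀ i j, f (i + j) - f i ∈ I ^ (i + k) := by
    intro i j
    induction j with
    | zero => simp
    | succ j ih =>
      have h1 : f (i + j + 1) - f (i + j) ∈ I ^ (i + k) :=
        Ideal.pow_le_pow_right (by omega) (hf (i + j))
      have := add_mem h1 ih
      rwa [sub_add_sub_cancel] at this
  obtain ⟨L, hL⟩ := IsPrecomplete.prec' (I := I) f (fun {m n} hmn => by
    rw [SModEq.sub_mem, smul_eq_mul, Ideal.mul_top, ← neg_sub, neg_mem_iff]
    obtain ⟨j, rfl⟩ := Nat.exists_eq_add_of_le hmn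
    exact Ideal.pow_le_pow_right (Nat.le_add_right _ _) (hle m j))
  refine ⟨L, fun i => ?_⟩
  have h1 := hL (i + k)
  rw [SModEq.sub_mem, smul_eq_mul, Ideal.mul_top, ← neg_mem_iff, neg_sub] at h1
  have := add_mem h1 (hle i k)
  rwa [sub_add_sub_cancel] at this

theorem IsHausdorff.eq_zero_of_forall_mem_pow {D : Type*} [CommRing D] {I : Ideal D}
    [IsHausdorff I D] {x : D} (hx : ∀ n, x ∈ I ^ n) : x = 0 :=
  IsHausdorff.haus' (I := I) x fun n => by
    rw [SModEq.zero, smul_eq_mul, Ideal.mul_top]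
    exact hx n

theorem exists_isCoefficientSubring_of_charZero {D : Type*} [CommRing D] {I : Ideal D}
    (hI : I.IsMaximal) (hu : ∀ x ∉ I, IsUnit x) [IsAdicComplete I D] [CharZero (D ⧸ I)] :
    ∃ W : Subring D, IsCoefficientSubring I W 0 := by
  obtain ⟨W, hW, hsurj⟩ := exists_subring_section_of_charZero hI hu
  refine ⟨W, W.zero_mem, I.zero_mem, hsurj, fun w hw hwI n => ⟨0, W.zero_mem, ?_⟩, fun x hx => ?_⟩
  · rw [hW w hw hwI]
    simp
  · obtain ⟨w, hw, hxw⟩ := hx 1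
    suffices x - w = 0 by rwa [sub_eq_zero.mp this]
    refine IsHausdorff.eq_zero_of_forall_mem_pow (I := I) fun n => ?_
    obtain ⟨w', hw', hxw'⟩ := hx (n + 1)
    have : w - w' = 0 := by
      refine hW _ (sub_mem hw hw') ?_
      have h := sub_mem (Ideal.pow_le_self n.succ_ne_zero hxw') (by rwa [pow_one] at hxw)
      rwa [sub_sub_sub_cancel_left] at h
    rw [sub_eq_zero.mp this]
    exact Ideal.pow_le_pow_right n.le_succ hxw'

/-- The inductive step in the construction of a coefficient subring: refine a subring `V` that has
the expected properties modulo `I ^ n` to one having them modulo `I ^ (n + 1)`. -/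
theorem exists_subring_refinement {D : Type*} [CommRing D] {I : Ideal D} (hI : I.IsMaximal)
    (p : ℕ) [hp : Fact p.Prime] (hpI : (p : D) ∈ I) (n : ℕ) (hn : n ≠ 0) (V : Subring D)
    (hpow : ∀ x ∈ I ^ n, x ∈ V) (hsurj : ∀ d, ∃ v ∈ V, d - v ∈ I)
    (happ : ∀ v ∈ V, v ∈ I → ∃ w ∈ V, v - p * w ∈ I ^ n) :
    ∃ V' ≤ V, (∀ x ∈ I ^ (n + 1), x ∈ V') ∧ (∀ v ∈ V, ∃ v' ∈ V', v - v' ∈ I ^ n) ∧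
      ∀ v ∈ V', v ∈ I → ∃ w ∈ V', v - p * w ∈ I ^ (n + 1) := by
  let 𝔮 : Ideal V :=
    { carrier := {v | ∃ w ∈ V, (v : D) - p * w ∈ I ^ (n + 1)}
      zero_mem' := ⟨0, V.zero_mem, by simp⟩
      add_mem' := by
        rintro a b ⟨w, hw, ha⟩ ⟨w', hw', hb⟩
        refine ⟨w + w', add_mem hw hw', ?_⟩
        have := add_mem ha hb
        rwa [sub_add_sub_comm, ← mul_add] at this
      smul_mem' := by
        rintro c a ⟨w, hw, ha⟩
        refine ⟨c * w, mul_mem c.2 hw, ?_⟩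
        have := Ideal.mul_mem_left (I ^ (n + 1)) (c : D) ha
        rwa [mul_sub, mul_left_comm] at this }
  have h𝔮 : ∀ v : V, v ∈ 𝔮 ↔ ∃ w ∈ V, (v : D) - p * w ∈ I ^ (n + 1) := fun v => Iff.rfl
  let J : Ideal V := I.comap V.subtype
  have hJ : J.IsMaximal := by
    let := Ideal.Quotient.field I
    have hψ : Function.Surjective ((Ideal.Quotient.mk I).comp V.subtype) := by
      intro x
      obtain ⟨d, rfl⟩ := Ideal.Quotient.mk_surjective x
      obtain ⟨v, hv, hdv⟩ := hsurj d
      exact ⟨⟨v, hv⟩, (Ideal.Quotient.eq.mpr hdv).symm⟩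
    have hker := RingHom.ker_isMaximal_of_surjective _ hψ
    rwa [← RingHom.comap_ker, Ideal.mk_ker] at hker
  have h𝔮J : 𝔮 ≤ J := by
    rintro v ⟨w, hw, hv⟩
    have := add_mem (Ideal.pow_le_self n.succ_ne_zero hv) (I.mul_mem_right w hpI)
    rwa [sub_add_cancel] at this
  let π := Ideal.Quotient.mk 𝔮
  have hmem : ∀ v : V, π v ∈ J.map π ↔ (v : D) ∈ I := by
    intro v
    have : (J.map π).comap π = J := by
      rw [Ideal.comap_map_of_surjective' π Ideal.Quotient.mk_surjective, Ideal.mk_ker,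
        sup_eq_left.mpr h𝔮J]
    rw [← Ideal.mem_comap, this]
    rfl
  have hJmax : (J.map π).IsMaximal := by
    refine Ideal.IsMaximal.map_of_surjective_of_ker_le Ideal.Quotient.mk_surjective ?_
    rwa [Ideal.mk_ker]
  have hnt : Nontrivial (V ⧸ 𝔮) :=
    Ideal.Quotient.nontrivial_iff.mpr (ne_top_of_le_ne_top hJ.ne_top h𝔮J)
  have hchar : CharP (V ⧸ 𝔮) p := by
    refine (CharP.charP_iff_prime_eq_zero hp.out).mpr ?_
    rw [← map_natCast π, Ideal.Quotient.eq_zero_iff_mem]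
    exact ⟨1, V.one_mem, by simp⟩
  obtain ⟨T, hT, hTsurj⟩ := exists_subring_section_of_pow_eq_zero hJmax p (by
    intro x hx
    obtain ⟨v, rfl⟩ := Ideal.Quotient.mk_surjective x
    obtain ⟨w, hw, hv⟩ := happ v v.2 ((hmem v).mp hx)
    refine pow_eq_zero_of_le hp.out.two_le ?_
    rw [← map_pow, Ideal.Quotient.eq_zero_iff_mem]
    refine ⟨2 * w * v - p * w ^ 2, sub_mem (mul_mem (mul_mem (by exact_mod_cast natCast_mem V 2) hw)
      v.2) (mul_mem (natCast_mem V p) (pow_mem hw 2)), ?_⟩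
    have h2 := Ideal.mul_mem_mul hv hv
    rw [← pow_add] at h2
    have h3 := Ideal.pow_le_pow_right (show n + 1 ≤ n + n by omega) h2
    convert h3 using 1
    push_cast
    ring)
  have hV' : ∀ v, v ∈ (T.comap π).map V.subtype ↔ ∃ h : v ∈ V, π ⟨v, h⟩ ∈ T := fun v =>
    ⟨by rintro ⟨v, hv, rfl⟩; exact ⟨v.2, hv⟩, fun ⟨h, hv⟩ => ⟨⟨v, h⟩, hv, rfl⟩⟩
  have happrox : ∀ v ∈ V, ∃ v' ∈ (T.comap π).map V.subtype, v - v' ∈ I ^ n := by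
    intro v hv
    obtain ⟨t, ht, hvt⟩ := hTsurj (π ⟨v, hv⟩)
    obtain ⟨v₁, rfl⟩ := Ideal.Quotient.mk_surjective t
    rw [← map_sub] at hvt
    obtain ⟨w, hw, hvw⟩ := happ _ (⟨v, hv⟩ - v₁ : V).2 ((hmem _).mp hvt)
    refine ⟨v₁ + p * w, (hV' _).mpr ⟨add_mem v₁.2 (mul_mem (natCast_mem V p) hw), ?_⟩, ?_⟩
    · convert ht using 1
      refine Ideal.Quotient.eq.mpr ((h𝔮 _).mpr ⟨w, hw, ?_⟩)
      simp
    · convert hvw using 1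
      push_cast
      ring
  refine ⟨(T.comap π).map V.subtype, ?_, ?_, happrox, ?_⟩
  · rintro _ ⟨v, -, rfl⟩
    exact v.2
  · intro x hx
    refine (hV' x).mpr ⟨hpow x (Ideal.pow_le_pow_right n.le_succ hx), ?_⟩
    convert T.zero_mem
    exact Ideal.Quotient.eq_zero_iff_mem.mpr ⟨0, V.zero_mem, by simpa⟩
  · intro v hv hvI
    obtain ⟨hvV, hvT⟩ := (hV' v).mp hv
    obtain ⟨w, hw, hvw⟩ := Ideal.Quotient.eq_zero_iff_mem.mp (hT _ hvT ((hmem _).mpr hvI))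
    obtain ⟨w', hw', hww'⟩ := happrox w hw
    refine ⟨w', hw', ?_⟩
    have h1 : (p : D) * (w - w') ∈ I ^ (n + 1) := by
      rw [pow_succ']
      exact Ideal.mul_mem_mul hpI hww'
    convert add_mem hvw h1 using 1
    ring


theorem exists_isCoefficientSubring_natCast {D : Type*} [CommRing D] {I : Ideal D}
    (hI : I.IsMaximal) [IsAdicComplete I D] (p : ℕ) [hp : Fact p.Prime] (hpI : (p : D) ∈ I) :
    ∃ W : Subring D, IsCoefficientSubring I W p := by
  let P : ℕ → Subring D → Prop := fun n V =>
    (∀ x ∈ I ^ (n + 1), x ∈ V) ∧ (∀ d, ∃ v ∈ V, d - v ∈ I) ∧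
      ∀ v ∈ V, v ∈ I → ∃ w ∈ V, v - p * w ∈ I ^ (n + 1)
  have hstep : ∀ n V, P n V → ∃ V' ≤ V, P (n + 1) V' ∧ ∀ v ∈ V, ∃ v' ∈ V', v - v' ∈ I ^ (n + 1) := by
    rintro n V ⟨h1, h2, h3⟩
    obtain ⟨V', hle, h1', h2', h3'⟩ :=
      exists_subring_refinement hI p hpI (n + 1) n.succ_ne_zero V h1 h2 h3
    refine ⟨V', hle, ⟨h1', fun d => ?_, h3'⟩, h2'⟩
    obtain ⟨v, hv, hdv⟩ := h2 d
    obtain ⟨v', hv', hvv'⟩ := h2' v hv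
    have := add_mem hdv (Ideal.pow_le_self n.succ_ne_zero hvv')
    exact ⟨v', hv', by rwa [sub_add_sub_cancel] at this⟩
  have h0 : P 0 ⊤ := ⟨fun _ _ => Subring.mem_top _, fun d => ⟨d, Subring.mem_top _, by simp⟩,
    fun v _ hv => ⟨0, Subring.mem_top _, by simpa⟩⟩
  choose! next hnext_le hnext_P hnext using hstep
  let V : ℕ → Subring D := fun n => Nat.rec ⊤ next n
  have hVs : ∀ n, V (n + 1) = next n (V n) := fun n => rfl
  have hV : ∀ n, P n (V n) := fun n => by
    induction n with
    | zero => exact h0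
    | succ n ih => exact hnext_P n _ ih
  have hanti : Antitone V := antitone_nat_of_succ_le fun n => hnext_le n _ (hV n)
  have hclosed : ∀ x, (∀ n, ∃ w ∈ (⨅ n, V n : Subring D), x - w ∈ I ^ n) →
      x ∈ (⨅ n, V n : Subring D) := by
    refine fun x hx => Subring.mem_iInf.mpr fun n => ?_
    obtain ⟨w, hw, hxw⟩ := hx (n + 1)
    have := add_mem ((hV n).1 _ hxw) (Subring.mem_iInf.mp hw n)
    rwa [sub_add_cancel] at this
  have happrox : ∀ n, ∀ v ∈ V n, ∃ w ∈ (⨅ n, V n : Subring D), v - w ∈ I ^ (n + 1) := by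
    intro n v hv
    have hseq : ∀ i, ∀ v ∈ V (i + n), ∃ v' ∈ V (i + 1 + n), v - v' ∈ I ^ (i + (n + 1)) := by
      intro i v hv
      obtain ⟨v', hv', h⟩ := hnext _ _ (hV (i + n)) v hv
      exact ⟨v', by rwa [add_right_comm, hVs], h⟩
    choose! g hg hgsub using hseq
    let f : ℕ → D := fun i => Nat.rec v g i
    have hf : ∀ i, f i ∈ V (i + n) := fun i => by
      induction i with
      | zero => simpa [f] using hv
      | succ i ih => exact hg i _ ih
    obtain ⟨L, hL⟩ := IsPrecomplete.exists_forall_sub_mem (I := I) (n + 1) f (fun i => by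
      rw [← neg_mem_iff, neg_sub]
      exact hgsub i _ (hf i))
    refine ⟨L, Subring.mem_iInf.mpr fun j => ?_, ?_⟩
    · have h1 := (hV (j + n)).1 _ (hL j)
      have := add_mem h1 (hf j)
      rw [sub_add_cancel] at this
      exact hanti (Nat.le_add_right j n) this
    · have := hL 0
      rw [← neg_mem_iff, neg_sub] at this
      simpa [f] using this
  refine ⟨⨅ n, V n, natCast_mem _ p, hpI, fun d => ?_, fun w hw hwI n => ?_, hclosed⟩
  · simpa using happrox 0 d (Subring.mem_top d)
  · obtain ⟨y, hy, hwy⟩ := (hV n).2.2 w (Subring.mem_iInf.mp hw n) hwI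
    obtain ⟨y', hy', hyy'⟩ := happrox n y hy
    refine ⟨y', hy', Ideal.pow_le_pow_right n.le_succ ?_⟩
    have := add_mem hwy (Ideal.mul_mem_left _ (p : D) hyy')
    rwa [mul_sub, sub_add_sub_cancel] at this

section

open IsLocalRing

variable {D : Type*} [CommRing D] [IsDomain D] [IsNoetherianRing D] [IsLocalRing D]

theorem exists_eq_mul_of_forall_sub_mul_mem {W : Subring D}
    (hclosed : ∀ x, (∀ n, ∃ w ∈ W, x - w ∈ maximalIdeal D ^ n) → x ∈ W) {a x : D}
    (hx : ∀ n, ∃ y ∈ W, x - a * y ∈ maximalIdeal D ^ n) : ∃ y ∈ W, x = a * y := by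
  by_cases ha : a = 0
  · subst ha
    refine ⟨0, W.zero_mem, ?_⟩
    have h := Ideal.iInf_pow_eq_bot_of_isLocalRing (maximalIdeal D) (Ideal.IsPrime.ne_top')
    have : x ∈ ⨅ i, maximalIdeal D ^ i := by
      refine (Submodule.mem_iInf _).mpr fun n => ?_
      obtain ⟨y, -, hy⟩ := hx n
      simpa using hy
    rw [h] at this
    simpa using this
  have hxa : x ∈ Ideal.span {a} := by
    have h := Ideal.iInf_pow_smul_eq_bot_of_isLocalRing (M := D ⧸ Ideal.span {a})
      (maximalIdeal D) (Ideal.IsPrime.ne_top')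
    rw [← Ideal.Quotient.eq_zero_iff_mem, ← Submodule.mem_bot D, ← h]
    refine (Submodule.mem_iInf _).mpr fun n => ?_
    obtain ⟨y, -, hy⟩ := hx n
    have h1 : Ideal.Quotient.mk (Ideal.span {a}) x =
        (x - a * y) • (1 : D ⧸ Ideal.span {a}) := by
      rw [Algebra.smul_def, mul_one]
      refine Ideal.Quotient.eq.mpr ?_
      rw [sub_sub_cancel]
      exact Ideal.mul_mem_right _ _ (Ideal.mem_span_singleton_self a)
    rw [h1]
    exact Submodule.smul_mem_smul hy Submodule.mem_top
  obtain ⟨y, rfl⟩ := Ideal.mem_span_singleton'.mp hxa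
  refine ⟨y, hclosed y fun n => ?_, mul_comm _ _⟩
  obtain ⟨k, hk⟩ := Ideal.exists_pow_inf_eq_pow_smul (maximalIdeal D) (Ideal.span {a})
  obtain ⟨w, hw, hyw⟩ := hx (n + k)
  refine ⟨w, hw, ?_⟩
  have h1 : a * (y - w) ∈ maximalIdeal D ^ (n + k) • (⊤ : Ideal D) ⊓ Ideal.span {a} := by
    refine ⟨?_, Ideal.mul_mem_right _ _ (Ideal.mem_span_singleton_self a)⟩
    rw [smul_eq_mul, Ideal.mul_top]
    have h0 : a * (y - w) = y * a - a * w := by ring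
    rw [h0]
    exact hyw
  rw [hk (n + k) (Nat.le_add_left _ _), Nat.add_sub_cancel] at h1
  have h2 := Submodule.smul_mono le_rfl inf_le_right h1
  rw [smul_eq_mul, mul_comm, Ideal.mem_span_singleton_mul] at h2
  obtain ⟨z, hz, hza⟩ := h2
  rwa [← mul_left_cancel₀ ha hza]

namespace IsCoefficientSubring

variable {W : Subring D} {c : D} (hW : IsCoefficientSubring (maximalIdeal D) W c)
include hW

omit [IsDomain D] [IsNoetherianRing D] in
theorem isUnit (w : W) (hw : (w : D) ∉ maximalIdeal D) : IsUnit w := by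
  have hu : IsUnit (w : D) := by simpa using hw
  obtain ⟨u, hu⟩ := hu.exists_right_inv
  suffices u ∈ W from .of_mul_eq_one (⟨u, this⟩ : W) (Subtype.ext hu)
  refine hW.closed u fun n => ?_
  obtain ⟨y, hy, huy⟩ := hW.exists_sub_mem u
  let z : D := 1 - w * y
  have hz : z ∈ maximalIdeal D := by
    have : z = w * (u - y) := by simp only [z]; rw [mul_sub, hu]
    rw [this]
    exact Ideal.mul_mem_left _ _ huy
  have hzW : z ∈ W := sub_mem W.one_mem (mul_mem w.2 hy)
  refine ⟨y * ∑ i ∈ Finset.range n, z ^ i, mul_mem hy (sum_mem fun i _ => pow_mem hzW i), ?_⟩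
  have h := mul_neg_geom_sum z n
  have h2 : u - y * ∑ i ∈ Finset.range n, z ^ i = u * z ^ n := by
    have h3 : z ^ n = 1 - (1 - z) * ∑ i ∈ Finset.range n, z ^ i := by rw [h]; ring
    rw [h3]
    have h4 : 1 - z = w * y := by simp [z]
    rw [h4]
    linear_combination (∑ i ∈ Finset.range n, z ^ i) * y * hu
  rw [h2]
  exact Ideal.mul_mem_left _ _ (Ideal.pow_mem_pow hz n)

theorem dvd_of_mem (w : W) (hw : (w : D) ∈ maximalIdeal D) : ⟨c, hW.mem⟩ ∣ w := by
  obtain ⟨y, hy, h⟩ := exists_eq_mul_of_forall_sub_mul_mem hW.closed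
    (hW.exists_sub_mul_mem w w.2 hw)
  exact ⟨⟨y, hy⟩, Subtype.ext h⟩

omit [IsDomain D] [IsNoetherianRing D] in
theorem isLocalRing : IsLocalRing W := by
  refine .of_isUnit_or_isUnit_one_sub_self fun w => ?_
  by_cases h : (w : D) ∈ maximalIdeal D
  · refine .inr (hW.isUnit _ fun h' => ?_)
    have := add_mem h h'
    simp at this
  · exact .inl (hW.isUnit w h)

theorem eq_pow_mul (w : W) (hw : w ≠ 0) : ∃ n u, IsUnit u ∧ w = ⟨c, hW.mem⟩ ^ n * u := by
  by_contra! hcon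
  have hdvd : ∀ n, ⟨c, hW.mem⟩ ^ n ∣ w := by
    intro n
    induction n with
    | zero => simp
    | succ n ih =>
      obtain ⟨y, hy⟩ := ih
      have : (y : D) ∈ maximalIdeal D := by
        by_contra h
        exact hcon n y (hW.isUnit y h) hy
      obtain ⟨z, rfl⟩ := hW.dvd_of_mem y this
      exact ⟨z, by rw [hy]; ring⟩
  refine hw (Subtype.ext ?_)
  have h := Ideal.iInf_pow_eq_bot_of_isLocalRing (maximalIdeal D) (Ideal.IsPrime.ne_top')
  have : (w : D) ∈ ⨅ i, maximalIdeal D ^ i := by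
    refine (Submodule.mem_iInf _).mpr fun n => ?_
    obtain ⟨y, rfl⟩ := hdvd n
    exact Ideal.mul_mem_right _ _ (Ideal.pow_mem_pow hW.mem_ideal n)
  rw [h] at this
  simpa using this

theorem maximalIdeal_eq [IsLocalRing W] : maximalIdeal W = Ideal.span {⟨c, hW.mem⟩} := by
  refine le_antisymm (fun w hw => ?_) ?_
  · refine Ideal.mem_span_singleton.mpr (hW.dvd_of_mem w ?_)
    by_contra h
    exact hw (hW.isUnit w h)
  · rw [Ideal.span_singleton_le_iff_mem]
    intro h
    exact (mem_maximalIdeal _).mp hW.mem_ideal (h.map W.subtype)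

theorem isPrincipalIdealRing : IsPrincipalIdealRing W := by
  have := hW.isLocalRing
  refine .of_prime fun P hP => ?_
  by_cases hP0 : P = ⊥
  · rw [hP0]
    infer_instance
  obtain ⟨w, hwP, hw⟩ := Submodule.exists_mem_ne_zero_of_ne_bot hP0
  obtain ⟨n, x, hx, rfl⟩ := hW.eq_pow_mul w hw
  have h1 := hP.mem_of_pow_mem n ((hP.mem_or_mem hwP).resolve_right
    fun h => hP.ne_top (Ideal.eq_top_of_isUnit_mem _ h hx))
  have : P = maximalIdeal W := by
    refine le_antisymm (le_maximalIdeal hP.ne_top) ?_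
    rw [hW.maximalIdeal_eq]
    exact (Ideal.span_singleton_le_iff_mem _).mpr h1
  exact ⟨_, this.trans hW.maximalIdeal_eq⟩

theorem isAdicComplete [IsLocalRing W] [IsAdicComplete (maximalIdeal D) D] :
    IsAdicComplete (maximalIdeal W) W := by
  have := hW.isPrincipalIdealRing
  have : IsHausdorff (maximalIdeal W) W := inferInstance
  have : IsPrecomplete (maximalIdeal W) W := by
    refine ⟨fun f hf => ?_⟩
    have hpow : ∀ n (x : W), x ∈ (maximalIdeal W ^ n • ⊤ : Ideal W) ↔ ⟨c, hW.mem⟩ ^ n ∣ x := by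
      intro n x
      rw [smul_eq_mul, Ideal.mul_top, hW.maximalIdeal_eq, Ideal.span_singleton_pow,
        Ideal.mem_span_singleton]
    have hf' : ∀ m n, m ≤ n → ∃ y ∈ W, (f n : D) - f m = c ^ m * y := by
      intro m n hmn
      have := (SModEq.sub_mem.mp (hf hmn).symm)
      rw [hpow] at this
      obtain ⟨y, hy⟩ := this
      exact ⟨y, y.2, congrArg Subtype.val hy⟩
    obtain ⟨L, hL⟩ := IsPrecomplete.exists_forall_sub_mem (I := maximalIdeal D) 0 (fun n => (f n : D))
      (fun i => by
        obtain ⟨y, -, hy⟩ := hf' i (i + 1) i.le_succ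
        rw [hy]
        exact Ideal.mul_mem_right _ _ (Ideal.pow_mem_pow hW.mem_ideal i))
    have hLW : L ∈ W := hW.closed L fun n => ⟨f n, (f n).2, hL n⟩
    refine ⟨⟨L, hLW⟩, fun n => ?_⟩
    refine SModEq.symm (SModEq.sub_mem.mpr ?_)
    rw [hpow]
    obtain ⟨y, hy, hyL⟩ := exists_eq_mul_of_forall_sub_mul_mem (x := L - f n) (a := c ^ n)
      hW.closed (fun m => by
        obtain ⟨y, hy, hfy⟩ := hf' n (n + m) (Nat.le_add_right _ _)
        refine ⟨y, hy, Ideal.pow_le_pow_right (show m ≤ n + m + 0 by omega) ?_⟩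
        rw [← hfy, sub_sub_sub_cancel_right]
        exact hL (n + m))
    exact ⟨⟨y, hy⟩, Subtype.ext hyL⟩
  exact {}

end IsCoefficientSubring

end

theorem exists_isCoefficientSubring {D : Type*} [CommRing D] [IsDomain D] [IsLocalRing D]
    [IsAdicComplete (IsLocalRing.maximalIdeal D) D] :
    ∃ (W : Subring D) (c : D), IsCoefficientSubring (IsLocalRing.maximalIdeal D) W c ∧
      (c = 0 ∨ CharZero D) := by
  have hI : (IsLocalRing.maximalIdeal D).IsMaximal := inferInstance
  obtain ⟨p, hp⟩ := CharP.exists (D ⧸ IsLocalRing.maximalIdeal D)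
  rcases CharP.char_is_prime_or_zero (D ⧸ IsLocalRing.maximalIdeal D) p with h | rfl
  · have := Fact.mk h
    obtain ⟨W, hW⟩ := exists_isCoefficientSubring_natCast hI p (by
      rw [← Ideal.Quotient.eq_zero_iff_mem, map_natCast, CharP.cast_eq_zero])
    refine ⟨W, p, hW, or_iff_not_imp_left.mpr fun hp0 => ?_⟩
    obtain ⟨q, hq⟩ := CharP.exists D
    rcases CharP.char_is_prime_or_zero D q with hq' | rfl
    · exfalso
      have h1 : (q : D ⧸ IsLocalRing.maximalIdeal D) = 0 := by
        rw [← map_natCast (Ideal.Quotient.mk _), CharP.cast_eq_zero, map_zero]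
      have := (Nat.prime_dvd_prime_iff_eq h hq').mp ((CharP.cast_eq_zero_iff _ p q).mp h1)
      subst this
      exact hp0 (CharP.cast_eq_zero D p)
    · exact CharP.charP_to_charZero D
  · have := CharP.charP_to_charZero (D ⧸ IsLocalRing.maximalIdeal D)
    obtain ⟨W, hW⟩ := exists_isCoefficientSubring_of_charZero hI (fun x hx => by simpa using hx)
    exact ⟨W, 0, hW, .inl rfl⟩

section

variable {A : Type*} [CommRing A]

namespace PowerSeries

theorem coeff_mem_of_mem_comap_constantCoeff_pow {I : Ideal A} {n : ℕ} {f : PowerSeries A}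
    (hf : f ∈ (I.comap (constantCoeff (R := A))) ^ n) (i : ℕ) : coeff i f ∈ I ^ (n - i) := by
  induction n generalizing f i with
  | zero => simp
  | succ n ih =>
    rw [pow_succ] at hf
    refine Submodule.mul_induction_on hf (fun a ha b hb => ?_) (fun a b ha hb => ?_)
    · rw [coeff_mul]
      refine sum_mem fun x hx => ?_
      rw [Finset.HasAntidiagonal.mem_antidiagonal] at hx
      obtain ⟨j, k⟩ := x
      simp only at hx ⊢
      have h1 := ih ha j
      rcases Nat.eq_zero_or_pos k with rfl | hk
      · have hb' : coeff 0 b ∈ I := by simpa using hb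
        have := Ideal.mul_mem_mul h1 hb'
        rw [← pow_succ] at this
        exact Ideal.pow_le_pow_right (by omega) this
      · exact Ideal.mul_mem_right _ _ (Ideal.pow_le_pow_right (by omega) h1)
    · rw [map_add]
      exact add_mem ha hb

theorem C_mul_X_pow_mem_comap_constantCoeff_pow {I : Ideal A} {a : A} {m i n : ℕ} (ha : a ∈ I ^ m)
    (hn : n ≤ m + i) : C a * X ^ i ∈ (I.comap (constantCoeff (R := A))) ^ n := by
  refine Ideal.pow_le_pow_right hn ?_
  rw [pow_add]
  refine Ideal.mul_mem_mul ?_ (Ideal.pow_mem_pow (by simp) i)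
  have h1 : I.map (C (R := A)) ≤ I.comap (constantCoeff (R := A)) :=
    Ideal.map_le_iff_le_comap.mpr fun x hx => by simpa using hx
  have h2 := Ideal.mem_map_of_mem (C (R := A)) ha
  rw [Ideal.map_pow] at h2
  exact Ideal.pow_right_mono h1 m h2

theorem exists_eq_trunc_add_X_pow_mul (n : ℕ) (f : PowerSeries A) :
    ∃ g, f = (trunc n f : PowerSeries A) + X ^ n * g := by
  have : X ^ n ∣ f - (trunc n f : PowerSeries A) := by
    rw [X_pow_dvd_iff]
    intro m hm
    rw [map_sub, Polynomial.coeff_coe, coeff_trunc, if_pos hm, sub_self]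
  obtain ⟨g, hg⟩ := this
  exact ⟨g, by rw [← hg]; ring⟩

theorem coe_trunc_eq_sum (n : ℕ) (f : PowerSeries A) :
    (trunc n f : PowerSeries A) = ∑ i ∈ Finset.range n, C (coeff i f) * X ^ i := by
  ext m
  simp only [Polynomial.coeff_coe, coeff_trunc, map_sum, coeff_C_mul, coeff_X_pow, mul_ite, mul_one,
    mul_zero, Finset.sum_ite_eq, Finset.mem_range]

theorem mem_comap_constantCoeff_pow_iff {I : Ideal A} {n : ℕ} {f : PowerSeries A} :
    f ∈ (I.comap (constantCoeff (R := A))) ^ n ↔ ∀ i < n, coeff i f ∈ I ^ (n - i) := by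
  refine ⟨fun hf i _ => coeff_mem_of_mem_comap_constantCoeff_pow hf i, fun hf => ?_⟩
  obtain ⟨g, hg⟩ := exists_eq_trunc_add_X_pow_mul n f
  rw [hg, coe_trunc_eq_sum]
  refine add_mem (sum_mem fun i hi => ?_) (Ideal.mul_mem_right _ _ ?_)
  · exact C_mul_X_pow_mem_comap_constantCoeff_pow (hf i (Finset.mem_range.mp hi)) (by omega)
  · exact Ideal.pow_mem_pow (by simp) n

instance isAdicComplete_comap_constantCoeff (I : Ideal A) [IsAdicComplete I A] :
    IsAdicComplete (I.comap (constantCoeff (R := A))) (PowerSeries A) := by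
  have h1 : IsHausdorff (I.comap (constantCoeff (R := A))) (PowerSeries A) := by
    refine ⟨fun f hf => ?_⟩
    ext i
    refine IsHausdorff.eq_zero_of_forall_mem_pow (I := I) fun n => ?_
    have := hf (n + i)
    rw [SModEq.zero, smul_eq_mul, Ideal.mul_top] at this
    simpa using coeff_mem_of_mem_comap_constantCoeff_pow this i
  have h2 : IsPrecomplete (I.comap (constantCoeff (R := A))) (PowerSeries A) := by
    refine ⟨fun f hf => ?_⟩
    have hf' : ∀ m n, m ≤ n → ∀ i, coeff i (f n) - coeff i (f m) ∈ I ^ (m - i) := by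
      intro m n hmn i
      have := SModEq.sub_mem.mp (hf hmn).symm
      rw [smul_eq_mul, Ideal.mul_top] at this
      rw [← map_sub]
      exact coeff_mem_of_mem_comap_constantCoeff_pow this i
    have hlim : ∀ i, ∃ L, ∀ n, L - coeff i (f (n + i)) ∈ I ^ n := by
      intro i
      exact IsPrecomplete.exists_forall_sub_mem (I := I) 0 (fun n => coeff i (f (n + i)))
        (fun n => by simpa using hf' (n + i) (n + 1 + i) (by omega) i)
    choose L hL using hlim
    refine ⟨mk L, fun n => SModEq.symm (SModEq.sub_mem.mpr ?_)⟩
    rw [smul_eq_mul, Ideal.mul_top, mem_comap_constantCoeff_pow_iff]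
    intro i hi
    have := hL i (n - i)
    rw [Nat.sub_add_cancel hi.le] at this
    simpa using this
  exact {}

theorem maximalIdeal_eq_comap [IsLocalRing A] : IsLocalRing.maximalIdeal (PowerSeries A) =
    (IsLocalRing.maximalIdeal A).comap (constantCoeff (R := A)) := by
  ext f
  simp [IsLocalRing.mem_maximalIdeal, mem_nonunits_iff, isUnit_iff_constantCoeff]

instance isAdicComplete_maximalIdeal [IsLocalRing A]
    [IsAdicComplete (IsLocalRing.maximalIdeal A) A] :
    IsAdicComplete (IsLocalRing.maximalIdeal (PowerSeries A)) (PowerSeries A) := by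
  rw [maximalIdeal_eq_comap]
  infer_instance

theorem maximalIdeal_eq_span [IsLocalRing A] {s : Set A}
    (hs : IsLocalRing.maximalIdeal A = Ideal.span s) :
    IsLocalRing.maximalIdeal (PowerSeries A) = Ideal.span (insert X (C '' s)) := by
  rw [maximalIdeal_eq_comap]
  refine le_antisymm (fun f hf => ?_) (Ideal.span_le.mpr ?_)
  · obtain ⟨g, hg⟩ := exists_eq_trunc_add_X_pow_mul 1 f
    rw [hg]
    refine add_mem ?_ (Ideal.mul_mem_right _ _ ?_)
    · have h1 : (trunc 1 f : PowerSeries A) = C (constantCoeff f) := by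
        simp
      have h2 : constantCoeff f ∈ Ideal.span s := by rw [← hs]; exact hf
      rw [h1]
      have := Ideal.mem_map_of_mem (C (R := A)) h2
      rw [Ideal.map_span] at this
      exact Ideal.span_mono (Set.subset_insert _ _) this
    · rw [pow_one]
      exact Ideal.subset_span (Set.mem_insert _ _)
  · rintro _ (rfl | ⟨a, ha, rfl⟩)
    · simp
    · have : a ∈ IsLocalRing.maximalIdeal A := by rw [hs]; exact Ideal.subset_span ha
      simpa using this

theorem exists_ringHom_of_mem {D : Type*} [CommRing D] (I : Ideal D) [IsAdicComplete I D]
    (φ : A →+* D) {x : D} (hx : x ∈ I) : ∃ Φ : PowerSeries A →+* D, (∀ a, Φ (C a) = φ a) ∧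
      Φ X = x ∧ ∀ n f, Φ f - ∑ i ∈ Finset.range n, φ (coeff i f) * x ^ i ∈ I ^ n := by
  let s : PowerSeries A → ℕ → D := fun f n => ∑ i ∈ Finset.range n, φ (coeff i f) * x ^ i
  have hs : ∀ f n, s f n = (trunc n f).eval₂ φ x := by
    intro f n
    rw [eval₂_trunc_eq_sum_range]
  have hlim : ∀ f, ∃ L, ∀ n, L - s f n ∈ I ^ n := by
    intro f
    refine IsPrecomplete.exists_forall_sub_mem (I := I) 0 (s f) fun i => ?_
    simp only [s, Finset.sum_range_succ, add_sub_cancel_left, add_zero]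
    exact Ideal.mul_mem_left _ _ (Ideal.pow_mem_pow hx i)
  choose Φ hΦ using hlim
  have huniq : ∀ f y, (∀ n, y - s f n ∈ I ^ n) → Φ f = y := by
    intro f y hy
    rw [← sub_eq_zero]
    refine IsHausdorff.eq_zero_of_forall_mem_pow (I := I) fun n => ?_
    have := sub_mem (hΦ f n) (hy n)
    rwa [sub_sub_sub_cancel_right] at this
  have heval : ∀ (P : A[X]) n, P.eval₂ φ x - (trunc n (P : PowerSeries A)).eval₂ φ x ∈ I ^ n := by
    intro P n
    have : (Polynomial.X : A[X]) ^ n ∣ P - trunc n (P : PowerSeries A) := by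
      rw [Polynomial.X_pow_dvd_iff]
      intro m hm
      rw [Polynomial.coeff_sub, coeff_trunc, if_pos hm, Polynomial.coeff_coe, sub_self]
    obtain ⟨Q, hQ⟩ := this
    rw [← Polynomial.eval₂_sub, hQ, Polynomial.eval₂_mul, Polynomial.eval₂_X_pow]
    exact Ideal.mul_mem_right _ _ (Ideal.pow_mem_pow hx n)
  have hC : ∀ a, Φ (C a) = φ a := by
    refine fun a => huniq _ _ fun n => ?_
    have := heval (Polynomial.C a) n
    rwa [Polynomial.coe_C, ← hs, Polynomial.eval₂_C] at this
  refine ⟨{ toFun := Φ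
            map_one' := by simpa using hC 1
            map_zero' := by simpa using hC 0
            map_mul' := fun f g => huniq _ _ fun n => ?_
            map_add' := fun f g => huniq _ _ fun n => ?_ }, hC, ?_, fun n f => hΦ f n⟩
  · have h1 := heval (trunc n f * trunc n g) n
    rw [Polynomial.coe_mul, trunc_trunc_mul_trunc, ← hs, Polynomial.eval₂_mul, ← hs, ← hs] at h1
    have h2 := Ideal.mul_mem_right (Φ g) _ (hΦ f n)
    have h3 := Ideal.mul_mem_left _ (s f n) (hΦ g n)
    convert add_mem (add_mem h2 h3) h1 using 1
    ring
  · have := add_mem (hΦ f n) (hΦ g n)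
    convert this using 1
    simp only [s, map_add, add_mul, Finset.sum_add_distrib]
    ring
  · refine huniq _ _ fun n => ?_
    have := heval Polynomial.X n
    rwa [Polynomial.coe_X, ← hs, Polynomial.eval₂_X] at this

end PowerSeries

end

theorem CartierSeparating.powerSeries {R : Type*} [CommRing R] {p : ℕ} [ExpChar R p]
    (h : CartierSeparating R p) : CartierSeparating (PowerSeries R) p := by
  have hp : 0 < p := expChar_pos R p
  have : ExpChar (PowerSeries R) p :=
    expChar_of_injective_ringHom (f := PowerSeries.C (R := R)) PowerSeries.C_injective p
  intro s hs
  obtain ⟨m, hm⟩ : ∃ m, PowerSeries.coeff m s ≠ 0 := by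
    by_contra! h
    exact hs (PowerSeries.ext h)
  obtain ⟨l, hl, hl0⟩ := h _ hm
  let j := m % p
  have hj : j < p := Nat.mod_lt _ hp
  let T : PowerSeries R →+ PowerSeries R := AddMonoidHom.mk'
    (fun f => PowerSeries.mk fun n => l (PowerSeries.coeff (p * n + j) f)) fun f g => by
      ext n
      simp
  have hT : ∀ f n, PowerSeries.coeff n (T f) = l (PowerSeries.coeff (p * n + j) f) :=
    fun f n => PowerSeries.coeff_mk n fun n => l (PowerSeries.coeff (p * n + j) f)
  have hmonomial : ∀ (i : ℕ) (c : R) b, T ((PowerSeries.C c * PowerSeries.X ^ i) ^ p * b) =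
      PowerSeries.C c * PowerSeries.X ^ i * T b := by
    intro i c b
    ext n
    rw [hT, mul_pow, ← map_pow, ← pow_mul, mul_assoc, mul_assoc, PowerSeries.coeff_C_mul,
      PowerSeries.coeff_C_mul, hl, PowerSeries.coeff_X_pow_mul', PowerSeries.coeff_X_pow_mul']
    by_cases hi : i ≤ n
    · have h1 : i * p ≤ p * n + j := by nlinarith
      rw [if_pos hi, if_pos h1, hT]
      congr 3
      rw [Nat.mul_sub, mul_comm i p, Nat.sub_add_comm (Nat.mul_le_mul_left p hi)]
    · have h1 : ¬ i * p ≤ p * n + j := by nlinarith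
      rw [if_neg hi, if_neg h1, map_zero]
  have hsum : ∀ (f : PowerSeries R) b n, T ((PowerSeries.trunc n f : PowerSeries R) ^ p * b) =
      (PowerSeries.trunc n f : PowerSeries R) * T b := by
    intro f b n
    rw [PowerSeries.coe_trunc_eq_sum]
    induction n with
    | zero => simp [hp.ne']
    | succ n ih =>
      rw [Finset.sum_range_succ, add_pow_expChar, add_mul, map_add, ih, hmonomial, add_mul]
  refine ⟨T, fun a b => ?_, fun h0 => hl0 ?_⟩
  · ext i
    obtain ⟨g, hg⟩ := PowerSeries.exists_eq_trunc_add_X_pow_mul (i + 1) a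
    have h1 := hmonomial (i + 1) 1 (g ^ p * b)
    rw [map_one, one_mul, ← mul_assoc, ← mul_pow] at h1
    rw [hg, add_pow_expChar, add_mul, map_add, hsum, h1, add_mul, map_add, map_add, mul_assoc _ g,
      PowerSeries.coeff_X_pow_mul', PowerSeries.coeff_X_pow_mul', if_neg (by omega),
      if_neg (by omega)]
  · have := congrArg (PowerSeries.coeff (m / p)) h0
    rwa [hT, map_zero, Nat.div_add_mod] at this

/-- The elements of the fraction field of a domain that are almost integral lie in the domain. -/
def CompletelyIntegrallyClosed (A : Type*) [CommRing A] : Prop :=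
  ∀ g h c : A, h ≠ 0 → c ≠ 0 → (∀ n, h ^ n ∣ c * g ^ n) → h ∣ g

theorem completelyIntegrallyClosed_of_isNoetherianRing (A : Type*) [CommRing A] [IsDomain A]
    [IsNoetherianRing A] [IsIntegrallyClosed A] : CompletelyIntegrallyClosed A := by
  intro g h c hh hc hdvd
  let K := FractionRing A
  have hh' : algebraMap A K h ≠ 0 := by simpa using hh
  have : IsAlmostIntegral A (algebraMap A K g / algebraMap A K h) := by
    refine ⟨c, mem_nonZeroDivisors_of_ne_zero hc, fun n => ?_⟩
    obtain ⟨q, hq⟩ := hdvd n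
    refine ⟨q, ?_⟩
    rw [Algebra.smul_def, div_pow, ← mul_div_assoc, eq_div_iff (pow_ne_zero _ hh'), ← map_pow,
      ← map_mul, ← map_pow, ← map_mul, hq, mul_comm]
  obtain ⟨q, hq⟩ := IsIntegrallyClosed.isIntegral_iff.mp this.isIntegral
  refine ⟨q, IsFractionRing.injective A K ?_⟩
  rw [map_mul, hq, mul_div_cancel₀ _ hh']

theorem CompletelyIntegrallyClosed.isIntegrallyClosed {A : Type*} [CommRing A] [IsDomain A]
    (hA : CompletelyIntegrallyClosed A) : IsIntegrallyClosed A := by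
  refine (isIntegrallyClosed_iff (FractionRing A)).mpr fun {x} hx => ?_
  obtain ⟨g, h, hh, rfl⟩ := IsFractionRing.div_surjective (A := A) x
  have hh0 : h ≠ 0 := nonZeroDivisors.ne_zero hh
  have hh' : algebraMap A (FractionRing A) h ≠ 0 := by simpa using hh0
  obtain ⟨c, hc, hcn⟩ := hx.isAlmostIntegral
  obtain ⟨q, rfl⟩ := hA g h c hh0 (nonZeroDivisors.ne_zero hc) fun n => by
    obtain ⟨q, hq⟩ := hcn n
    refine ⟨q, IsFractionRing.injective A (FractionRing A) ?_⟩
    rw [Algebra.smul_def, div_pow, ← mul_div_assoc, eq_div_iff (pow_ne_zero _ hh')] at hq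
    rw [map_mul, map_mul, map_pow, map_pow, ← hq, mul_comm]
  exact ⟨q, by rw [map_mul, mul_div_cancel_left₀ _ hh']⟩

section

variable {A : Type*} [CommRing A] [IsDomain A]

namespace PowerSeries

theorem dvd_of_dvd_X_pow_mul {h f : PowerSeries A} (h0 : constantCoeff h ≠ 0) {n : ℕ}
    (hdvd : h ∣ X ^ n * f) : h ∣ f := by
  obtain ⟨q, hq⟩ := hdvd
  have h1 : ¬ X ∣ h := by rwa [X_dvd_iff]
  obtain ⟨r, rfl⟩ : X ^ n ∣ q := (X_prime.pow_dvd_of_dvd_mul_left n h1 ⟨f, hq.symm⟩)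
  refine ⟨r, mul_left_cancel₀ (pow_ne_zero n X_ne_zero) ?_⟩
  rw [hq]
  ring

omit [IsDomain A] in
theorem exists_eq_X_pow_mul {f : PowerSeries A} (hf : f ≠ 0) :
    ∃ n g, f = X ^ n * g ∧ constantCoeff g ≠ 0 := by
  obtain ⟨g, hg⟩ := X_pow_order_dvd (φ := f)
  refine ⟨_, g, hg, fun h0 => ?_⟩
  obtain ⟨g', rfl⟩ := X_dvd_iff.mpr h0
  have h1 : X ^ (f.order.toNat + 1) ∣ f := ⟨g', by rw [pow_succ, mul_assoc, ← hg]⟩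
  have h2 := (X_pow_dvd_iff.mp h1) f.order.toNat (Nat.lt_succ_self _)
  exact coeff_order hf h2

theorem _root_.CompletelyIntegrallyClosed.powerSeries (hA : CompletelyIntegrallyClosed A) :
    CompletelyIntegrallyClosed (PowerSeries A) := by
  have key : ∀ g h c : PowerSeries A, constantCoeff h ≠ 0 → c ≠ 0 → (∀ n, h ^ n ∣ c * g ^ n) →
      h ∣ g := by
    intro g h c hh hc hdvd
    obtain ⟨b, c, rfl, hc0⟩ := exists_eq_X_pow_mul hc
    replace hdvd : ∀ n, h ^ n ∣ c * g ^ n := fun n => by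
      refine dvd_of_dvd_X_pow_mul (n := b) (by rw [map_pow]; exact pow_ne_zero _ hh) ?_
      rw [← mul_assoc]
      exact hdvd n
    have hstep : ∀ g, (∀ n, h ^ n ∣ c * g ^ n) → ∃ (q : A) (g' : PowerSeries A),
        g = h * C q + X * g' ∧ ∀ n, h ^ n ∣ c * g' ^ n := by
      intro g hg
      obtain ⟨q, hq⟩ := hA (constantCoeff g) (constantCoeff h) (constantCoeff c) hh hc0 fun n => by
        have := map_dvd (constantCoeff (R := A)) (hg n)
        simpa using this
      obtain ⟨g', hg'⟩ : X ∣ g - h * C q := by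
        rw [X_dvd_iff, map_sub, map_mul, hq, constantCoeff_C, sub_self]
      refine ⟨q, g', by rw [← hg']; ring, fun n => ?_⟩
      refine dvd_of_dvd_X_pow_mul (n := n) (by rw [map_pow]; exact pow_ne_zero _ hh) ?_
      have h1 : X ^ n * (c * g' ^ n) = c * (g - h * C q) ^ n := by rw [hg']; ring
      rw [h1, sub_eq_add_neg, add_pow, Finset.mul_sum]
      refine Finset.dvd_sum fun i hi => ?_
      obtain ⟨r, hr⟩ := hg i
      have hi : i ≤ n := Nat.lt_succ_iff.mp (Finset.mem_range.mp hi)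
      refine ⟨r * (-C q) ^ (n - i) * (n.choose i), ?_⟩
      obtain ⟨k, rfl⟩ := Nat.exists_eq_add_of_le hi
      rw [Nat.add_sub_cancel_left, ← mul_assoc, ← mul_assoc, hr, pow_add]
      ring
    choose! q next hq hnext using hstep
    let G : ℕ → PowerSeries A := fun n => Nat.rec g (fun _ x => next x) n
    have hGs : ∀ n, G (n + 1) = next (G n) := fun n => rfl
    have hG : ∀ n, ∀ m, h ^ m ∣ c * G n ^ m := fun n => by
      induction n with
      | zero => exact hdvd
      | succ n ih => exact hnext _ ih
    let Q : PowerSeries A := mk fun n => q (G n)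
    have hQ : ∀ n, g = h * (trunc n Q : PowerSeries A) + X ^ n * G n := by
      intro n
      rw [coe_trunc_eq_sum]
      induction n with
      | zero => simp [G]
      | succ n ih =>
        rw [Finset.sum_range_succ, coeff_mk, hGs]
        conv_lhs => rw [ih, hq _ (hG n)]
        ring
    refine ⟨Q, ext fun n => ?_⟩
    obtain ⟨r, hr⟩ := exists_eq_trunc_add_X_pow_mul (n + 1) Q
    have h1 : g - h * Q = X ^ (n + 1) * (G (n + 1) - h * r) := by
      linear_combination hQ (n + 1) - h * hr
    rw [← sub_eq_zero, ← map_sub, h1, coeff_X_pow_mul', if_neg (by omega)]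
  intro g h c hh hc hdvd
  by_cases hg : g = 0
  · rw [hg]
    exact dvd_zero h
  obtain ⟨a, h, rfl, hh0⟩ := exists_eq_X_pow_mul hh
  obtain ⟨d, g, rfl, hg0⟩ := exists_eq_X_pow_mul hg
  obtain ⟨b, c, rfl, hc0⟩ := exists_eq_X_pow_mul hc
  have hle : ∀ n, a * n ≤ b + d * n := by
    intro n
    have h1 : X ^ (a * n) ∣ X ^ (b + d * n) * (c * g ^ n) := by
      have := (Dvd.intro _ (mul_pow (X ^ a) h n).symm).trans (hdvd n)
      rw [← pow_mul] at this
      convert this using 1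
      ring
    by_contra! hlt
    have h2 := X_pow_dvd_iff.mp h1 (b + d * n) hlt
    rw [coeff_X_pow_mul', if_pos le_rfl, Nat.sub_self, coeff_zero_eq_constantCoeff, map_mul,
      map_pow] at h2
    exact mul_ne_zero hc0 (pow_ne_zero _ hg0) h2
  have had : a ≤ d := by
    have := hle (b + 1)
    by_contra! hlt
    nlinarith
  refine mul_dvd_mul (pow_dvd_pow X had) ?_
  refine key g h c hh0 (by rintro rfl; simp at hc0) fun n => ?_
  have h1 := (Dvd.intro_left _ (mul_pow (X ^ a) h n).symm).trans (hdvd n)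
  refine dvd_of_dvd_X_pow_mul (n := b + d * n) (by rw [map_pow]; exact pow_ne_zero _ hh0) ?_
  convert h1 using 1
  ring

end PowerSeries

end

section

open IsLocalRing

theorem isPrecomplete_pi {A : Type*} [CommRing A] (I : Ideal A) [IsPrecomplete I A]
    (ι : Type*) [Fintype ι] : IsPrecomplete I (ι → A) := by
  classical
  have hmem : ∀ (J : Ideal A) (x : ι → A), x ∈ (J • ⊤ : Submodule A (ι → A)) ↔ ∀ i, x i ∈ J := by
    refine fun J x => ⟨fun hx i => ?_, fun hx => ?_⟩
    · refine Submodule.smul_induction_on hx (fun r hr y _ => ?_) (fun y z hy hz => ?_)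
      · exact J.mul_mem_right _ hr
      · exact add_mem hy hz
    · rw [pi_eq_sum_univ x]
      exact sum_mem fun i _ => Submodule.smul_mem_smul (hx i) Submodule.mem_top
  refine ⟨fun f hf => ?_⟩
  have hlim : ∀ i, ∃ L, ∀ n, L - f n i ∈ I ^ n := fun i =>
    IsPrecomplete.exists_forall_sub_mem (I := I) 0 (fun n => f n i) fun n =>
      (hmem _ _).mp (SModEq.sub_mem.mp (hf n.le_succ).symm) i
  choose L hL using hlim
  exact ⟨L, fun n => (SModEq.sub_mem.mpr ((hmem _ _).mpr fun i => hL i n)).symm⟩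

theorem IsLocalRing.maximalIdeal_mem_minimalPrimes {R : Type*} [CommRing R] [IsLocalRing R]
    {I : Ideal R} (hI : I ≤ maximalIdeal R)
    (h : ∀ P : Ideal R, P.IsPrime → I ≤ P → maximalIdeal R ≤ P) :
    maximalIdeal R ∈ I.minimalPrimes :=
  ⟨⟨inferInstance, hI⟩, fun P hP _ => h P hP.1 hP.2⟩

theorem IsLocalRing.le_of_maximalIdeal_mem_minimalPrimes {R : Type*} [CommRing R] [IsLocalRing R]
    {I : Ideal R} (hI : maximalIdeal R ∈ I.minimalPrimes) {P : Ideal R} (hP : P.IsPrime)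
    (h : I ≤ P) : maximalIdeal R ≤ P :=
  hI.2 ⟨hP, h⟩ (le_maximalIdeal hP.ne_top)

theorem exists_finset_insert_minimalPrimes {R : Type*} [CommRing R] [IsDomain R]
    [IsNoetherianRing R] [IsLocalRing R] {a : R} (ha : a ≠ 0) (ham : a ∈ maximalIdeal R) :
    ∃ t : Finset R, maximalIdeal R ∈ (Ideal.span (insert a (t : Set R))).minimalPrimes ∧
      ((t.card + 1 : ℕ) : ℕ∞) ≤ (maximalIdeal R).height := by
  classical
  let B := R ⧸ Ideal.span {a}
  have hB : Nontrivial B := Ideal.Quotient.nontrivial_iff.mpr fun h =>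
    (maximalIdeal.isMaximal R).ne_top (top_le_iff.mp (h ▸ (Ideal.span_singleton_le_iff_mem _).mpr ham))
  let π : R →+* B := Ideal.Quotient.mk _
  have hπ : Function.Surjective π := Ideal.Quotient.mk_surjective
  have : IsLocalRing B := .of_surjective' π hπ
  have : IsLocalHom π := .of_surjective π hπ
  obtain ⟨s, hs, hcard⟩ := (maximalIdeal B).exists_finset_card_eq_height_of_isNoetherianRing
  have hdim := ringKrullDim_quotient_succ_le_of_nonZeroDivisor (mem_nonZeroDivisors_of_ne_zero ha)
  rw [← maximalIdeal_height_eq_ringKrullDim (R := R),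
    ← maximalIdeal_height_eq_ringKrullDim (R := B), ← hcard] at hdim
  obtain ⟨t, ht, htcard⟩ : ∃ t : Finset R, t.image π = s ∧ t.card = s.card := by
    refine ⟨s.image (Function.surjInv hπ), ?_, ?_⟩
    · have h1 : π ∘ Function.surjInv hπ = id := funext (Function.surjInv_eq hπ)
      rw [Finset.image_image, h1, Finset.image_id]
    · exact Finset.card_image_of_injective _ (Function.injective_surjInv hπ)
  refine ⟨t, IsLocalRing.maximalIdeal_mem_minimalPrimes ?_ fun P hP hle => ?_, ?_⟩
  · rw [Ideal.span_le, Set.insert_subset_iff]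
    refine ⟨ham, fun x hx => ?_⟩
    have h1 : π x ∈ maximalIdeal B := by
      refine hs.1.2 (Ideal.subset_span ?_)
      rw [← ht]
      exact_mod_cast Finset.mem_image_of_mem π hx
    rwa [← Ideal.mem_comap, maximalIdeal_comap] at h1
  · have haP : a ∈ P := hle (Ideal.subset_span (Set.mem_insert _ _))
    have hker : RingHom.ker π ≤ P := by
      rw [Ideal.mk_ker]
      exact (Ideal.span_singleton_le_iff_mem _).mpr haP
    have hP' : (P.map π).IsPrime := Ideal.map_isPrime_of_surjective hπ hker
    have h1 : maximalIdeal B ≤ P.map π := by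
      refine IsLocalRing.le_of_maximalIdeal_mem_minimalPrimes hs hP' (Ideal.span_le.mpr ?_)
      rw [← ht, Finset.coe_image]
      rintro _ ⟨x, hx, rfl⟩
      exact Ideal.mem_map_of_mem _ (hle (Ideal.subset_span (Set.mem_insert_of_mem _ hx)))
    have h2 := Ideal.comap_mono (f := π) h1
    rwa [maximalIdeal_comap, Ideal.comap_map_of_surjective' π hπ, sup_eq_left.mpr hker] at h2
  · rw [htcard]
    exact_mod_cast hdim

theorem exists_finite_of_isAdicComplete {A D : Type*} [CommRing A] [CommRing D] [IsLocalRing D]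
    [IsNoetherianRing D] [Algebra A D] (I : Ideal A) [IsPrecomplete I A]
    (hI : maximalIdeal D ∈ (I.map (algebraMap A D)).minimalPrimes)
    (hres : ∀ d : D, ∃ a : A, d - algebraMap A D a ∈ maximalIdeal D) : Module.Finite A D := by
  classical
  let K := I.map (algebraMap A D)
  have hK : K ≤ maximalIdeal D := hI.1.2
  obtain ⟨N, hN⟩ : ∃ N, maximalIdeal D ^ N ≤ K := by
    refine Ideal.exists_pow_le_of_le_radical_of_fg ?_ (IsNoetherian.noetherian _)
    rw [Ideal.radical_eq_sInf]
    exact le_sInf fun P hP => IsLocalRing.le_of_maximalIdeal_mem_minimalPrimes hI hP.2 hP.1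
  have hF : ∀ i, ∃ G : Finset D, ⊤ ≤ Submodule.span A (G : Set D) ⊔
      (maximalIdeal D ^ i).restrictScalars A := by
    intro i
    induction i with
    | zero => exact ⟨∅, by simp⟩
    | succ i ih =>
      obtain ⟨G, hG⟩ := ih
      obtain ⟨G', hG'⟩ := IsNoetherian.noetherian (maximalIdeal D ^ i)
      refine ⟨G ∪ G', hG.trans (sup_le ?_ ?_)⟩
      · exact le_sup_of_le_left (Submodule.span_mono (by simp))
      · have key : ∀ x ∈ Ideal.span (G' : Set D), x ∈ Submodule.span A (G' : Set D) ⊔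
            (maximalIdeal D ^ (i + 1)).restrictScalars A := by
          intro x hx
          induction hx using Submodule.span_induction with
          | mem x hx => exact Submodule.mem_sup_left (Submodule.subset_span hx)
          | zero => exact zero_mem _
          | add x y _ _ hx hy => exact add_mem hx hy
          | smul d x hx ih =>
            obtain ⟨a, ha⟩ := hres d
            have h1 : d • x = a • x + (d - algebraMap A D a) * x := by
              rw [smul_eq_mul, Algebra.smul_def]
              ring
            rw [h1]
            refine add_mem (Submodule.smul_mem _ _ ih) (Submodule.mem_sup_right ?_)
            change _ ∈ maximalIdeal D ^ (i + 1)
            rw [pow_succ']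
            refine Ideal.mul_mem_mul ha ?_
            rw [← hG']
            exact hx
        intro x hx
        have hx' : x ∈ Ideal.span (G' : Set D) := by
          change x ∈ maximalIdeal D ^ i at hx
          rwa [← hG'] at hx
        have hle : Submodule.span A (G' : Set D) ≤ Submodule.span A ((G ∪ G' : Finset D) : Set D) :=
          Submodule.span_mono (by simp)
        exact sup_le_sup hle le_rfl (key x hx')
  obtain ⟨G, hG⟩ := hF N
  have hsmul : ∀ J : Ideal A, (J • ⊤ : Submodule A D) =
      (J.map (algebraMap A D)).restrictScalars A := fun J => Ideal.smul_top_eq_map J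
  have : IsHausdorff I D := by
    refine ⟨fun x hx => ?_⟩
    refine IsHausdorff.eq_zero_of_forall_mem_pow (I := maximalIdeal D) fun n => ?_
    have h1 := hx n
    rw [SModEq.zero, hsmul, Ideal.map_pow] at h1
    exact Ideal.pow_right_mono hK n h1
  have : IsPrecomplete I (G → A) := isPrecomplete_pi I G
  let f : (G → A) →ₗ[A] D := Fintype.linearCombination A ((↑) : G → D)
  have hrange : LinearMap.range f = Submodule.span A (G : Set D) := by
    rw [Fintype.range_linearCombination, Subtype.range_coe]
  refine Module.Finite.of_surjective f (surjective_of_mkQ_comp_surjective (I := I) ?_)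
  rw [← LinearMap.range_eq_top, LinearMap.range_comp, hrange, Submodule.map_mkQ_eq_top, sup_comm,
    eq_top_iff]
  refine hG.trans (sup_le_sup_left ?_ _)
  rw [hsmul]
  exact hN

end

section

open IsLocalRing

variable {D : Type u} [CommRing D] [IsDomain D] [IsNoetherianRing D] [IsLocalRing D]
  [IsAdicComplete (maximalIdeal D) D]

/-- Given elements of the maximal ideal of a complete local domain with coefficient ring `W`, the
power series ring over `W` in as many variables, mapping to the domain. -/
theorem IsCoefficientSubring.exists_powerSeries {W : Subring D} {c : D}
    (hW : IsCoefficientSubring (maximalIdeal D) W c) {δ : ℕ} (hδ : c = 0 ∨ 1 ≤ δ) (p : ℕ)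
    [ExpChar W p] (hp : CartierSeparating W p) (l : List D) (hl : ∀ x ∈ l, x ∈ maximalIdeal D) :
    ∃ (A : Type u) (_ : CommRing A) (_ : IsDomain A) (_ : IsNoetherianRing A) (_ : IsLocalRing A)
      (_ : IsAdicComplete (maximalIdeal A) A) (_ : ExpChar A p) (φ : A →+* D) (s : Set A),
      CompletelyIntegrallyClosed A ∧ CartierSeparating A p ∧ s.Finite ∧ s.ncard ≤ δ + l.length ∧
      maximalIdeal A = Ideal.span s ∧
      (maximalIdeal A).map φ = Ideal.span (insert c {x | x ∈ l}) ∧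
      ∀ d, ∃ a, d - φ a ∈ maximalIdeal D := by
  induction l with
  | nil =>
    have := hW.isLocalRing
    have := hW.isPrincipalIdealRing
    have hmap : (maximalIdeal W).map W.subtype = Ideal.span (insert c {x | x ∈ ([] : List D)}) := by
      rw [hW.maximalIdeal_eq, Ideal.map_span]
      simp
    have hres : ∀ d, ∃ a : W, d - W.subtype a ∈ maximalIdeal D := fun d => by
      obtain ⟨w, hw, h⟩ := hW.exists_sub_mem d
      exact ⟨⟨w, hw⟩, h⟩
    rcases hδ with rfl | hδ
    · refine ⟨W, inferInstance, inferInstance, inferInstance, inferInstance, hW.isAdicComplete,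
        inferInstance, W.subtype, ∅, completelyIntegrallyClosed_of_isNoetherianRing W, hp,
        Set.finite_empty, by simp, ?_, hmap, hres⟩
      rw [hW.maximalIdeal_eq, Ideal.span_empty, Ideal.span_singleton_eq_bot]
      rfl
    · exact ⟨W, inferInstance, inferInstance, inferInstance, inferInstance, hW.isAdicComplete,
        inferInstance, W.subtype, {⟨c, hW.mem⟩},
        completelyIntegrallyClosed_of_isNoetherianRing W, hp,
        Set.finite_singleton _, by simpa, hW.maximalIdeal_eq, hmap, hres⟩
  | cons x l ih =>
    obtain ⟨A, _, _, _, _, _, _, φ, s, hA, hpA, hs, hcard, hmax, hmap, hres⟩ :=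
      ih fun y hy => hl y (List.mem_cons_of_mem _ hy)
    obtain ⟨Φ, hΦC, hΦX, -⟩ :=
      PowerSeries.exists_ringHom_of_mem (maximalIdeal D) φ (hl x List.mem_cons_self)
    refine ⟨PowerSeries A, inferInstance, inferInstance, inferInstance, inferInstance,
      inferInstance, expChar_of_injective_ringHom (f := PowerSeries.C (R := A))
        PowerSeries.C_injective p, Φ, insert PowerSeries.X (PowerSeries.C '' s), hA.powerSeries,
      hpA.powerSeries, (hs.image _).insert _, ?_, PowerSeries.maximalIdeal_eq_span hmax, ?_,
      fun d => ?_⟩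
    · have h1 := Set.ncard_insert_le (PowerSeries.X : PowerSeries A) (PowerSeries.C '' s)
      have h2 := Set.ncard_image_le (f := PowerSeries.C (R := A)) hs
      rw [List.length_cons]
      omega
    · have h1 : Φ '' (PowerSeries.C '' s) = φ '' s := by
        rw [Set.image_image]
        simp only [hΦC]
      have h2 : ({y | y ∈ x :: l} : Set D) = insert x {y | y ∈ l} := by
        ext
        simp
      rw [PowerSeries.maximalIdeal_eq_span hmax, Ideal.map_span, Set.image_insert_eq, hΦX, h1, h2,
        Set.insert_comm, Ideal.span_insert, Ideal.span_insert x, ← hmap, hmax, Ideal.map_span]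
    · obtain ⟨a, ha⟩ := hres d
      exact ⟨PowerSeries.C a, by rwa [hΦC]⟩

omit [IsAdicComplete (maximalIdeal D) D] in
theorem exists_list_insert_minimalPrimes {c : D} (hc : c ∈ maximalIdeal D) :
    ∃ (δ : ℕ) (l : List D), (c = 0 ∨ 1 ≤ δ) ∧ (∀ x ∈ l, x ∈ maximalIdeal D) ∧
      maximalIdeal D ∈ (Ideal.span (insert c {x | x ∈ l})).minimalPrimes ∧
      ((δ + l.length : ℕ) : ℕ∞) ≤ (maximalIdeal D).height := by
  by_cases hc0 : c = 0
  · subst hc0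
    obtain ⟨t, ht, hcard⟩ := (maximalIdeal D).exists_finset_card_eq_height_of_isNoetherianRing
    refine ⟨0, t.toList, .inl rfl, fun x hx => ht.1.2 (Ideal.subset_span (by simpa using hx)), ?_,
      by simp [hcard]⟩
    simpa [Ideal.span_insert] using ht
  · obtain ⟨t, ht, hcard⟩ := exists_finset_insert_minimalPrimes hc0 hc
    refine ⟨1, t.toList, .inr le_rfl,
      fun x hx => ht.1.2 (Ideal.subset_span (Set.mem_insert_of_mem _ (by simpa using hx))), ?_, ?_⟩
    · simpa using ht
    · rwa [Finset.length_toList, add_comm]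

theorem FiniteNormalization.of_isCoefficientSubring {W : Subring D} {c : D}
    (hW : IsCoefficientSubring (maximalIdeal D) W c) (p : ℕ) [ExpChar W p]
    (hp : CartierSeparating W p) : FiniteNormalization D := by
  obtain ⟨δ, l, hδ, hl, hmin, hheight⟩ := exists_list_insert_minimalPrimes hW.mem_ideal
  obtain ⟨A, _, _, _, _, _, _, φ, s, hA, hpA, hs, hcard, hmax, hmap, hres⟩ :=
    hW.exists_powerSeries hδ p hp l hl
  let := φ.toAlgebra
  rw [← hmap] at hmin
  have : Module.Finite A D := exists_finite_of_isAdicComplete (maximalIdeal A) hmin hres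
  have : IsIntegrallyClosed A := hA.isIntegrallyClosed
  refine FiniteNormalization.of_finite A p hpA ((injective_iff_map_eq_zero φ).mpr fun a ha => ?_)
  by_contra ha0
  have ham : a ∈ maximalIdeal A := fun h => by
    have := h.map φ
    rw [ha] at this
    exact not_isUnit_zero this
  obtain ⟨t, ht, htcard⟩ := exists_finset_insert_minimalPrimes ha0 ham
  have h1 : maximalIdeal D ∈ (Ideal.span (φ '' t)).minimalPrimes := by
    refine IsLocalRing.maximalIdeal_mem_minimalPrimes ?_ fun P hP hle => ?_
    · rw [← Ideal.map_span]
      exact (Ideal.map_mono ((Ideal.span_mono (Set.subset_insert _ _)).trans ht.1.2)).trans hmin.1.2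
    · refine IsLocalRing.le_of_maximalIdeal_mem_minimalPrimes hmin hP (Ideal.map_le_iff_le_comap.mpr ?_)
      refine IsLocalRing.le_of_maximalIdeal_mem_minimalPrimes ht (hP.comap φ) ?_
      rw [Ideal.span_le, Set.insert_subset_iff]
      refine ⟨?_, fun x hx => hle (Ideal.subset_span (Set.mem_image_of_mem _ hx))⟩
      change φ a ∈ P
      rw [ha]
      exact P.zero_mem
  have h2 := Ideal.height_le_card_of_mem_minimalPrimes_span (t.finite_toSet.image φ) h1
  have h3 : (φ '' t).ncard ≤ t.card := by
    simpa using Set.ncard_image_le (f := φ) t.finite_toSet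
  have h4 : (maximalIdeal A).height ≤ s.ncard := by
    refine Ideal.height_le_card_of_mem_minimalPrimes_span hs ?_
    rw [← hmax]
    exact IsLocalRing.maximalIdeal_mem_minimalPrimes le_rfl fun _ _ h => h
  have h5 := htcard.trans (h4.trans ((Nat.cast_le.mpr hcard).trans (hheight.trans h2)))
  rw [Nat.cast_le] at h5
  omega

theorem FiniteNormalization.of_isAdicComplete : FiniteNormalization D := by
  obtain ⟨W, c, hW, rfl | h⟩ := exists_isCoefficientSubring (D := D)
  · have hfield : IsField W := by
      refine ⟨⟨0, 1, zero_ne_one⟩, mul_comm, fun {w} hw => ?_⟩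
      refine (hW.isUnit w fun hwI => hw ?_).exists_right_inv
      obtain ⟨y, rfl⟩ := hW.dvd_of_mem w hwI
      exact zero_mul y
    obtain ⟨p, hp⟩ := ExpChar.exists W
    refine .of_isCoefficientSubring hW p ?_
    let := hfield.toField
    exact cartierSeparating_field W p
  · have : CharZero W := ⟨fun a b hab => by
      exact_mod_cast congrArg Subtype.val hab⟩
    exact .of_isCoefficientSubring hW 1 (cartierSeparating_one W)

end

theorem IsPrecomplete.of_surjective {B D : Type*} [CommRing B] [CommRing D] {I : Ideal B}
    {K : Ideal D} [IsPrecomplete I B] {π : B →+* D} (hπ : Function.Surjective π)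
    (hK : K = I.map π) : IsPrecomplete K D where
  prec' f hf := by
    have hlift : ∀ n, ∃ e ∈ I ^ n, π e = f (n + 1) - f n := by
      intro n
      have h := (hf (Nat.le_succ n)).symm
      rw [SModEq.sub_mem, smul_eq_mul, Ideal.mul_top, hK, ← Ideal.map_pow] at h
      exact (Ideal.mem_map_iff_of_surjective π hπ).mp h
    choose e he hef using hlift
    obtain ⟨g, hg⟩ := hπ (f 0)
    have hsum : ∀ n, π (g + ∑ i ∈ Finset.range n, e i) = f n := by
      intro n
      rw [map_add, map_sum, hg, Finset.sum_congr rfl fun i _ => hef i, Finset.sum_range_sub]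
      ring
    obtain ⟨L, hL⟩ := IsPrecomplete.exists_forall_sub_mem (I := I) 0
      (fun n => g + ∑ i ∈ Finset.range n, e i) fun i => by
        rw [Finset.sum_range_succ, ← add_assoc, add_sub_cancel_left]
        exact he i
    refine ⟨π L, fun n => ?_⟩
    rw [SModEq.comm, SModEq.sub_mem, smul_eq_mul, Ideal.mul_top, hK, ← Ideal.map_pow, ← hsum n,
      ← map_sub]
    exact Ideal.mem_map_of_mem π (hL n)

section

open IsLocalRing

theorem IsLocalRing.maximalIdeal_eq_map_of_surjective {B D : Type*} [CommRing B] [CommRing D]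
    [IsLocalRing B] [IsLocalRing D] {π : B →+* D} (hπ : Function.Surjective π) :
    maximalIdeal D = (maximalIdeal B).map π := by
  refine le_antisymm (fun y hy => ?_) (Ideal.map_le_iff_le_comap.mpr fun x hx => ?_)
  · obtain ⟨x, rfl⟩ := hπ y
    exact Ideal.mem_map_of_mem π fun hx => hy (hx.map π)
  · by_contra h
    have hu : IsUnit (π x) := by simpa using h
    obtain ⟨z, hz⟩ := hu.exists_right_inv
    obtain ⟨y, rfl⟩ := hπ z
    have h1 : 1 - x * y ∈ maximalIdeal B := by
      intro hv
      have := hv.map π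
      rw [map_sub, map_one, map_mul, hz, sub_self] at this
      exact not_isUnit_zero this
    have : (1 : B) ∈ maximalIdeal B := by
      have := add_mem h1 (Ideal.mul_mem_right y _ hx)
      rwa [sub_add_cancel] at this
    exact this isUnit_one

theorem exists_isAdicComplete_ringHom_powerSeries {S : Type u} [CommRing S] [IsNoetherianRing S]
    [IsLocalRing S] [IsAdicComplete (maximalIdeal S) S] {J : Ideal S} (l : List S)
    (hl : ∀ g ∈ l, g ∈ J) :
    ∃ (B : Type u) (_ : CommRing B) (_ : IsNoetherianRing B) (_ : IsLocalRing B)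
      (_ : IsAdicComplete (maximalIdeal B) B) (Ψ : B →+* PowerSeries S),
      (∀ b n, PowerSeries.coeff n (Ψ b) ∈ J ^ n) ∧ (∀ s, ∃ b, Ψ b = PowerSeries.C s) ∧
      ∀ g ∈ l, ∃ b, Ψ b = PowerSeries.C g * PowerSeries.X := by
  induction l with
  | nil =>
    refine ⟨S, inferInstance, inferInstance, inferInstance, inferInstance, PowerSeries.C,
      fun b n => ?_, fun s => ⟨s, rfl⟩, by simp⟩
    rw [PowerSeries.coeff_C]
    split_ifs with h <;> simp [h]
  | cons g l ih =>
    obtain ⟨B, _, _, _, _, Ψ, hcoeff, hC, hX⟩ := ih fun x hx => hl x (List.mem_cons_of_mem g hx)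
    obtain ⟨Φ, hΦC, hΦX, hΦ⟩ := PowerSeries.exists_ringHom_of_mem
      (Ideal.span {(PowerSeries.X : PowerSeries S)}) Ψ (x := PowerSeries.C g * PowerSeries.X)
      (Ideal.mul_mem_left _ _ (Ideal.mem_span_singleton_self _))
    refine ⟨PowerSeries B, inferInstance, inferInstance, inferInstance, inferInstance, Φ,
      fun f n => ?_, fun s => ?_, fun x hx => ?_⟩
    · have h := hΦ (n + 1) f
      rw [Ideal.span_singleton_pow, Ideal.mem_span_singleton, PowerSeries.X_pow_dvd_iff] at h
      have h := h n n.lt_succ_self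
      rw [map_sub, sub_eq_zero] at h
      rw [h, map_sum]
      refine sum_mem fun i hi => ?_
      have hi : i ≤ n := Nat.lt_succ_iff.mp (Finset.mem_range.mp hi)
      rw [mul_pow, ← map_pow, ← mul_assoc, PowerSeries.coeff_mul_X_pow', if_pos hi,
        PowerSeries.coeff_mul_C]
      have := Ideal.mul_mem_mul (hcoeff (PowerSeries.coeff i f) (n - i))
        (Ideal.pow_mem_pow (hl g List.mem_cons_self) i)
      rwa [← pow_add, Nat.sub_add_cancel hi] at this
    · obtain ⟨b, hb⟩ := hC s
      exact ⟨PowerSeries.C b, (hΦC b).trans hb⟩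
    · rcases List.mem_cons.mp hx with rfl | hx
      · exact ⟨PowerSeries.X, hΦX⟩
      · obtain ⟨b, hb⟩ := hX x hx
        exact ⟨PowerSeries.C b, (hΦC b).trans hb⟩

theorem exists_intClosure_pow_le_of_isAdicComplete {S : Type u} [CommRing S] [IsDomain S]
    [IsNoetherianRing S] [IsLocalRing S] [IsAdicComplete (maximalIdeal S) S] {J : Ideal S}
    (hJ : J ≠ ⊥) : ∃ c, ∀ n, intClosure (J ^ (n + c)) ≤ J ^ n := by
  obtain ⟨t, ht⟩ := IsNoetherian.noetherian J
  obtain ⟨B, _, _, _, _, Ψ, hcoeff, hC, hX⟩ :=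
    exists_isAdicComplete_ringHom_powerSeries (J := J) t.toList fun g hg =>
      ht ▸ Ideal.subset_span (Finset.mem_toList.mp hg)
  have hsurj := Ψ.rangeRestrict_surjective
  have : IsNoetherianRing Ψ.range := isNoetherianRing_of_surjective _ _ _ hsurj
  have : IsLocalRing Ψ.range := IsLocalRing.of_surjective' _ hsurj
  have : IsPrecomplete (maximalIdeal Ψ.range) Ψ.range :=
    IsPrecomplete.of_surjective hsurj (IsLocalRing.maximalIdeal_eq_map_of_surjective hsurj)
  have : IsAdicComplete (maximalIdeal Ψ.range) Ψ.range := { }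
  refine exists_intClosure_pow_le_of_finiteNormalization
    (FiniteNormalization.of_isAdicComplete (D := Ψ.range)) hJ Ψ.range.subtype
    Subtype.val_injective ?_ (fun s => ?_) fun g hg => ?_
  · rintro ⟨_, b, rfl⟩ n
    exact hcoeff b n
  · obtain ⟨b, hb⟩ := hC s
    exact ⟨⟨_, b, rfl⟩, hb⟩
  · suffices PowerSeries.C g * PowerSeries.X ∈ Ψ.range from ⟨⟨_, this⟩, rfl⟩
    rw [← ht] at hg
    induction hg using Submodule.span_induction with
    | mem x hx => exact hX x (Finset.mem_toList.mpr hx)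
    | zero => simp
    | add x y _ _ hx hy =>
      rw [map_add, add_mul]
      exact add_mem hx hy
    | smul s x _ hx =>
      rw [smul_eq_mul, map_mul, mul_assoc]
      exact mul_mem (hC s) hx

theorem AdmissibleDomain.exists_intClosure_pow_le {S : Type u} [CommRing S] [IsDomain S]
    [IsNoetherianRing S] (hS : AdmissibleDomain S) {J : Ideal S} (hJ : J ≠ ⊥) :
    ∃ c, ∀ n, intClosure (J ^ (n + c)) ≤ J ^ n := by
  rcases hS with ⟨_, m, hm, huniq, hcomplete⟩ | ⟨F, hfg⟩ | _ | hB
  · have : IsLocalRing S := IsLocalRing.of_unique_max_ideal ⟨m, hm, huniq⟩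
    obtain rfl := huniq (maximalIdeal S) inferInstance
    exact exists_intClosure_pow_le_of_isAdicComplete hJ
  · exact exists_intClosure_pow_le_of_finiteType_field F hJ
  · exact exists_intClosure_pow_le_of_finiteType_int hJ
  · exact exists_intClosure_pow_le_of_nagataBase hB.some hJ

end

/-- **Theorem.** Let `S` be a domain which is a complete local Noetherian ring, or finitely
generated over a field or `ℤ`, or more generally finitely generated over a Noetherian
integrally closed domain `R` such that every finitely generated `R`-algebra has module-finite
integral closure. Let `a` be a filtration and `b` a graded family of nonzero ideals with
`ℛ^{[k]}(b)` a standard graded `S`-algebra and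
`ρ(a, overline{(b k)^•}) = k·ρ(a, overline{(b 1)^•})`. Then
`ρ̂(a, b) = ρ̂(a, b̄) = ρ(a, b̄)`. -/
theorem statement14 {S : Type u} [CommRing S] [IsDomain S] [IsNoetherianRing S]
    (hS : AdmissibleDomain S)
    (a b : ℕ → Ideal S) (ha : IdealFiltration a) (hb : GradedFamily b)
    (hanz : ∀ i : ℕ, 1 ≤ i → a i ≠ ⊥) (hbnz : ∀ i : ℕ, 1 ≤ i → b i ≠ ⊥)
    (k : ℕ) (hk : 0 < k) (hst : StdVeronese b k)
    (hhyp : resurgence a (fun i => intClosure (b k ^ i)) =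
      ((k : ℝ) : EReal) * resurgence a (fun i => intClosure (b 1 ^ i))) :
    asympResurgence a b = asympResurgence a (fun i => intClosure (b i)) ∧
      asympResurgence a (fun i => intClosure (b i)) =
        resurgence a (fun i => intClosure (b i)) := by
  obtain ⟨c, hc⟩ := hS.exists_intClosure_pow_le (hbnz k hk)
  exact resurgence_eq_of_intClosure_pow_le ha hb hk hst hhyp hc
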